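/- Let 1 < p ≤ 2 and k = 2d(1/p − 1/2). There exists a constant C > 0 such that for all f ∈ 𝓢(ℝ^d): ‖f‖_{M^p} ≤ C ‖f‖_{L^p_k} and ‖f‖_{L^p} ≤ C ‖f‖_{M^p}. (That is, the continuous embeddings L^p_k(ℝ^d) ↪ M^p(ℝ^d) ↪ L^p(ℝ^d) hold.) -/

import Mathlib

open MeasureTheory Real Filter
open scoped RealInnerProductSpace ENNReal

noncomputable section

/-- The Gaussian window `g(t) = e^{-π|t|²}`. -/
def gaussWindow {d : ℕ} (t : EuclideanSpace ℝ (Fin d)) : ℂ :=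
  (Real.exp (-π * ‖t‖ ^ 2) : ℝ)

/-- The short-time Fourier transform with Gaussian window:
`V_g f(x,ξ) = ∫ e^{-2πi ξ·t} f(t) g(t-x) dt`. -/
def STFT {d : ℕ} (f : EuclideanSpace ℝ (Fin d) → ℂ)
    (x ξ : EuclideanSpace ℝ (Fin d)) : ℂ :=
  ∫ (t : EuclideanSpace ℝ (Fin d)),
    Complex.exp (-(((2 * π * ⟪ξ, t⟫ : ℝ) : ℂ) * Complex.I)) * f t * gaussWindow (t - x)

/-- The modulation space norm `‖f‖_{M^p} = (∫∫ |V_g f(x,ξ)|^p dx dξ)^{1/p}`. -/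
def MpNorm {d : ℕ} (p : ℝ) (f : EuclideanSpace ℝ (Fin d) → ℂ) : ℝ≥0∞ :=
  eLpNorm (fun z : EuclideanSpace ℝ (Fin d) × EuclideanSpace ℝ (Fin d) =>
    STFT f z.1 z.2) (ENNReal.ofReal p) volume

/-- The Fourier transform `𝓕f(ξ) = ∫ e^{-2πi ξ·x} f(x) dx`. -/
def FT {d : ℕ} (f : EuclideanSpace ℝ (Fin d) → ℂ) (ξ : EuclideanSpace ℝ (Fin d)) : ℂ :=
  ∫ (x : EuclideanSpace ℝ (Fin d)),
    Complex.exp (-(((2 * π * ⟪ξ, x⟫ : ℝ) : ℂ) * Complex.I)) * f x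

/-- The inverse Fourier transform `𝓕⁻¹h(x) = ∫ e^{2πi x·ξ} h(ξ) dξ`. -/
def IFT {d : ℕ} (h : EuclideanSpace ℝ (Fin d) → ℂ) (x : EuclideanSpace ℝ (Fin d)) : ℂ :=
  ∫ (ξ : EuclideanSpace ℝ (Fin d)),
    Complex.exp ((((2 * π * ⟪x, ξ⟫ : ℝ) : ℂ) * Complex.I)) * h ξ

/-- The Bessel potential Sobolev norm `‖f‖_{L^p_k} = ‖𝓕⁻¹(⟨·⟩^k 𝓕f)‖_{L^p}`. -/
def sobolevNorm {d : ℕ} (p k : ℝ) (f : EuclideanSpace ℝ (Fin d) → ℂ) : ℝ≥0∞ :=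
  eLpNorm (IFT fun ξ => (((1 + ‖ξ‖ ^ 2) ^ (k / 2) : ℝ) : ℂ) * FT f ξ)
    (ENNReal.ofReal p) volume

open scoped FourierTransform SchwartzMap

section FourierL2

open scoped ContDiff

variable {E : Type*} [NormedAddCommGroup E] [InnerProductSpace ℝ E] [FiniteDimensional ℝ E]
  [MeasurableSpace E] [BorelSpace E]

/-- The Fourier transform is self-adjoint for the bilinear pairing of integrable functions. -/
theorem integral_fourier_mul_eq_of_integrable {u v : E → ℂ} (hu : Integrable u)
    (hv : Integrable v) : ∫ ξ, 𝓕 u ξ * v ξ = ∫ x, u x * 𝓕 v x := by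
  simpa using! VectorFourier.integral_bilin_fourierIntegral_eq_flip (.mul ℂ ℂ) (L := innerₗ E)
    continuous_fourierChar continuous_inner hu hv

theorem continuous_fourier_of_integrable {u : E → ℂ} (hu : Integrable u) : Continuous (𝓕 u) :=
  VectorFourier.fourierIntegral_continuous continuous_fourierChar (L := innerₗ E)
    continuous_inner hu

theorem norm_fourier_le_integral_norm (u : E → ℂ) (ξ : E) : ‖𝓕 u ξ‖ ≤ ∫ x, ‖u x‖ :=
  VectorFourier.norm_fourierIntegral_le_integral_norm _ _ _ _ _

/-- **Plancherel** for the integral Fourier transform on `L¹ ∩ L²`. -/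
theorem eLpNorm_fourier_eq {u : E → ℂ} (h1 : Integrable u) (h2 : MemLp u 2) :
    eLpNorm (𝓕 u) 2 = eLpNorm u 2 := by
  set U : Lp ℂ 2 (volume : Measure E) := 𝓕 (h2.toLp u) with hU
  have hae : (U : E → ℂ) =ᵐ[volume] 𝓕 u := by
    refine ae_eq_of_integral_contDiff_smul_eq
      ((Lp.memLp U).locallyIntegrable (by norm_num))
      (continuous_fourier_of_integrable h1).locallyIntegrable ?_
    intro g hg hgc
    have hgc' : HasCompactSupport (Complex.ofRealCLM ∘ g) := hgc.comp_left rfl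
    have hg' : ContDiff ℝ ∞ (Complex.ofRealCLM ∘ g) := by fun_prop
    set φ : 𝓢(E, ℂ) := hgc'.toSchwartzMap hg'
    have hφg (x : E) : φ x = (g x : ℂ) := rfl
    have key := congrArg (fun T => T φ) (Lp.fourier_toTemperedDistribution_eq (h2.toLp u))
    simp only [TemperedDistribution.fourier_apply, Lp.toTemperedDistribution_apply] at key
    have e1 : ∫ x, g x • (U : E → ℂ) x = ∫ x, φ x • (U : E → ℂ) x := by
      simp [hφg]
    have e2 : ∫ x, g x • 𝓕 u x = ∫ x, 𝓕 u x * φ x := by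
      simp [hφg, mul_comm]
    rw [e1, e2, ← key, integral_fourier_mul_eq_of_integrable h1 φ.integrable]
    refine integral_congr_ae ?_
    filter_upwards [h2.coeFn_toLp] with x hx
    rw [hx, smul_eq_mul, mul_comm, SchwartzMap.fourier_coe]
  rw [← eLpNorm_congr_ae hae]
  have h3 : ‖U‖ = ‖h2.toLp u‖ := Lp.norm_fourier_eq _
  rw [Lp.norm_def, Lp.norm_def, ENNReal.toReal_eq_toReal_iff' (Lp.eLpNorm_ne_top _)
    (Lp.eLpNorm_ne_top _)] at h3
  rw [h3, eLpNorm_congr_ae h2.coeFn_toLp]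

theorem eLpNorm_fourierInv_eq {u : E → ℂ} (h1 : Integrable u) (h2 : MemLp u 2) :
    eLpNorm (𝓕⁻ u) 2 = eLpNorm u 2 := by
  have hmp : MeasurePreserving (fun x : E => -x) := Measure.measurePreserving_neg volume
  have : 𝓕⁻ u = 𝓕 u ∘ fun x => -x := by
    ext w; exact Real.fourierInv_eq_fourier_neg u w
  rw [this, eLpNorm_comp_measurePreserving
    (continuous_fourier_of_integrable h1).aestronglyMeasurable hmp, eLpNorm_fourier_eq h1 h2]

theorem lintegral_enorm_sq_eq_eLpNorm {α : Type*} [MeasurableSpace α] {μ : Measure α}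
    (u : α → ℂ) : ∫⁻ x, ‖u x‖ₑ ^ 2 ∂μ = eLpNorm u 2 μ ^ 2 := by
  have := eLpNorm_nnreal_pow_eq_lintegral (μ := μ) (f := u) (p := 2) (by norm_num)
  simpa using this.symm

theorem lintegral_fourier_sq_eq {u : E → ℂ} (h1 : Integrable u) (h2 : MemLp u 2) :
    ∫⁻ ξ, ‖𝓕 u ξ‖ₑ ^ 2 = ∫⁻ x, ‖u x‖ₑ ^ 2 := by
  rw [lintegral_enorm_sq_eq_eLpNorm, lintegral_enorm_sq_eq_eLpNorm, eLpNorm_fourier_eq h1 h2]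

theorem lintegral_fourierInv_sq_eq {u : E → ℂ} (h1 : Integrable u) (h2 : MemLp u 2) :
    ∫⁻ ξ, ‖𝓕⁻ u ξ‖ₑ ^ 2 = ∫⁻ x, ‖u x‖ₑ ^ 2 := by
  rw [lintegral_enorm_sq_eq_eLpNorm, lintegral_enorm_sq_eq_eLpNorm, eLpNorm_fourierInv_eq h1 h2]

end FourierL2

section RealInterpolation

theorem setLIntegral_Ioc_zero_rpow {a r : ℝ} (ha : 0 ≤ a) (hr : -1 < r) :
    ∫⁻ t in Set.Ioc 0 a, ENNReal.ofReal (t ^ r) = ENNReal.ofReal (a ^ (r + 1) / (r + 1)) := by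
  rw [← ofReal_integral_eq_lintegral_ofReal]
  · rw [← intervalIntegral.integral_of_le ha, integral_rpow (Or.inl hr),
      Real.zero_rpow (by linarith), sub_zero]
  · exact (intervalIntegrable_iff_integrableOn_Ioc_of_le ha).1
      (intervalIntegral.intervalIntegrable_rpow' hr)
  · filter_upwards [ae_restrict_mem measurableSet_Ioc] with t ht
    exact Real.rpow_nonneg ht.1.le _

theorem setLIntegral_Ioi_rpow {a r : ℝ} (ha : 0 < a) (hr : r < -1) :
    ∫⁻ t in Set.Ioi a, ENNReal.ofReal (t ^ r) = ENNReal.ofReal (-a ^ (r + 1) / (r + 1)) := by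
  rw [← ofReal_integral_eq_lintegral_ofReal]
  · rw [integral_Ioi_rpow_of_lt hr ha]
  · exact integrableOn_Ioi_rpow_of_lt hr ha
  · filter_upwards [ae_restrict_mem measurableSet_Ioi] with t ht
    exact Real.rpow_nonneg (ha.trans ht).le _

variable {α β : Type*} [MeasurableSpace α] [MeasurableSpace β] {μ : Measure α} {ν : Measure β}

theorem lintegral_indicator_lt_rpow {p a : ℝ} (hp1 : 1 < p) (ha : 0 ≤ a) :
    ∫⁻ t in Set.Ioi 0, ENNReal.ofReal (t ^ (p - 2)) *
      (if t < a then ENNReal.ofReal a else 0) ≤ ENNReal.ofReal (1 / (p - 1)) *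
        ENNReal.ofReal (a ^ p) := by
  calc ∫⁻ t in Set.Ioi 0, ENNReal.ofReal (t ^ (p - 2)) * (if t < a then ENNReal.ofReal a else 0)
      ≤ ∫⁻ t in Set.Ioi 0, (Set.Ioc 0 a).indicator
          (fun t => ENNReal.ofReal (t ^ (p - 2)) * ENNReal.ofReal a) t := by
        refine setLIntegral_mono' measurableSet_Ioi fun t ht => ?_
        split_ifs with h
        · rw [Set.indicator_of_mem (show t ∈ Set.Ioc 0 a from ⟨ht, h.le⟩)]
        · simp
    _ ≤ ∫⁻ t, (Set.Ioc 0 a).indicator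
          (fun t => ENNReal.ofReal (t ^ (p - 2)) * ENNReal.ofReal a) t :=
        setLIntegral_le_lintegral _ _
    _ = ENNReal.ofReal (a ^ (p - 1) / (p - 1)) * ENNReal.ofReal a := by
        rw [lintegral_indicator measurableSet_Ioc, lintegral_mul_const _ (by fun_prop),
          setLIntegral_Ioc_zero_rpow ha (by linarith)]
        ring_nf
    _ = _ := by
        have hp : 0 < p - 1 := by linarith
        rw [← ENNReal.ofReal_mul (by positivity), ← ENNReal.ofReal_mul (by positivity)]
        congr 1
        rcases ha.eq_or_lt with rfl | h
        · simp [Real.zero_rpow (by linarith : p ≠ 0)]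
        · rw [Real.rpow_sub_one h.ne']; field_simp

theorem lintegral_indicator_ge_rpow {p a : ℝ} (hp2 : p < 2) (ha : 0 ≤ a) :
    ∫⁻ t in Set.Ioi 0, ENNReal.ofReal (t ^ (p - 3)) *
      (if a ≤ t then ENNReal.ofReal (a ^ 2) else 0) ≤ ENNReal.ofReal (1 / (2 - p)) *
        ENNReal.ofReal (a ^ p) := by
  rcases ha.eq_or_lt with rfl | h
  · simp
  have hp : 0 < 2 - p := by linarith
  calc ∫⁻ t in Set.Ioi 0, ENNReal.ofReal (t ^ (p - 3)) *
          (if a ≤ t then ENNReal.ofReal (a ^ 2) else 0)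
      ≤ ∫⁻ t in Set.Ioi 0, (Set.Ici a).indicator
          (fun t => ENNReal.ofReal (t ^ (p - 3)) * ENNReal.ofReal (a ^ 2)) t := by
        refine setLIntegral_mono' measurableSet_Ioi fun t ht => ?_
        split_ifs with h
        · rw [Set.indicator_of_mem (Set.mem_Ici.2 h)]
        · simp
    _ ≤ ∫⁻ t, (Set.Ici a).indicator
          (fun t => ENNReal.ofReal (t ^ (p - 3)) * ENNReal.ofReal (a ^ 2)) t :=
        setLIntegral_le_lintegral _ _
    _ = ENNReal.ofReal (a ^ (p - 2) / (2 - p)) * ENNReal.ofReal (a ^ 2) := by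
        rw [lintegral_indicator measurableSet_Ici, lintegral_mul_const _ (by fun_prop),
          setLIntegral_congr Ioi_ae_eq_Ici.symm, setLIntegral_Ioi_rpow h (by linarith)]
        congr 2
        rw [show p - 3 + 1 = -(2 - p) by ring, show p - 2 = -(2 - p) by ring, neg_div_neg_eq]
    _ = _ := by
        rw [← ENNReal.ofReal_mul (by positivity), ← ENNReal.ofReal_mul (by positivity)]
        congr 1
        rw [show p - 2 = p - (2 : ℕ) by norm_num, Real.rpow_sub_natCast h.ne']; field_simp

/-- Real interpolation between a weak `L¹` bound and a weak `L²` bound: the distribution function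
of `u` is controlled by the large part of `h` in `L¹` and by its small part in `L²`. -/
theorem lintegral_rpow_le_of_distribution_le [SFinite μ] {p : ℝ} (hp1 : 1 < p) (hp2 : p < 2)
    {h : α → ℝ} (hm : Measurable h) (h0 : ∀ x, 0 ≤ h x) {u : β → ℝ} (um : AEMeasurable u ν)
    (u0 : ∀ y, 0 ≤ u y) (A B : ℝ≥0∞)
    (H : ∀ t : ℝ, 0 < t → ν {y | t < u y} ≤
      A * ENNReal.ofReal t⁻¹ * ∫⁻ x in {x | t < h x}, ENNReal.ofReal (h x) ∂μ +
      B * ENNReal.ofReal (t⁻¹ ^ 2) * ∫⁻ x in {x | h x ≤ t}, ENNReal.ofReal (h x ^ 2) ∂μ) :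
    ∫⁻ y, ENNReal.ofReal (u y ^ p) ∂ν ≤ ENNReal.ofReal p * (A * ENNReal.ofReal (1 / (p - 1)) +
      B * ENNReal.ofReal (1 / (2 - p))) * ∫⁻ x, ENNReal.ofReal (h x ^ p) ∂μ := by
  rw [lintegral_rpow_eq_lintegral_meas_lt_mul ν (.of_forall u0) um (by linarith), mul_assoc]
  gcongr
  have m1 : Measurable fun z : ℝ × α =>
      ENNReal.ofReal (z.1 ^ (p - 2)) * (if z.1 < h z.2 then ENNReal.ofReal (h z.2) else 0) :=
    (by fun_prop : Measurable fun z : ℝ × α => ENNReal.ofReal (z.1 ^ (p - 2))).mul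
      (Measurable.ite (measurableSet_lt (by fun_prop) (by fun_prop)) (by fun_prop) (by fun_prop))
  have m2 : Measurable fun z : ℝ × α =>
      ENNReal.ofReal (z.1 ^ (p - 3)) * (if h z.2 ≤ z.1 then ENNReal.ofReal (h z.2 ^ 2) else 0) :=
    (by fun_prop : Measurable fun z : ℝ × α => ENNReal.ofReal (z.1 ^ (p - 3))).mul
      (Measurable.ite (measurableSet_le (by fun_prop) (by fun_prop)) (by fun_prop) (by fun_prop))
  calc ∫⁻ t in Set.Ioi 0, ν {a | t < u a} * ENNReal.ofReal (t ^ (p - 1))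
      ≤ ∫⁻ t in Set.Ioi 0, (A * ∫⁻ x, ENNReal.ofReal (t ^ (p - 2)) *
          (if t < h x then ENNReal.ofReal (h x) else 0) ∂μ +
          B * ∫⁻ x, ENNReal.ofReal (t ^ (p - 3)) *
          (if h x ≤ t then ENNReal.ofReal (h x ^ 2) else 0) ∂μ) := by
        refine setLIntegral_mono' measurableSet_Ioi fun t ht => ?_
        have ht : 0 < t := ht
        refine (mul_le_mul_left (H t ht) _).trans (le_of_eq ?_)
        rw [lintegral_const_mul' _ _ ENNReal.ofReal_ne_top,
          lintegral_const_mul' _ _ ENNReal.ofReal_ne_top,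
          ← lintegral_indicator (measurableSet_lt measurable_const hm),
          ← lintegral_indicator (measurableSet_le hm measurable_const),
          show t ^ (p - 2) = t⁻¹ * t ^ (p - 1) by
            rw [show p - 2 = p - 1 - 1 by ring, Real.rpow_sub_one ht.ne' (p - 1)]; field_simp,
          show t ^ (p - 3) = t⁻¹ ^ 2 * t ^ (p - 1) by
            rw [show p - 3 = p - 1 - (2 : ℕ) by norm_num; ring, Real.rpow_sub_natCast ht.ne']
            field_simp,
          ENNReal.ofReal_mul (by positivity), ENNReal.ofReal_mul (by positivity)]
        simp only [Set.indicator_apply, Set.mem_ofPred_eq]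
        ring
    _ = A * ∫⁻ x, (∫⁻ t in Set.Ioi 0, ENNReal.ofReal (t ^ (p - 2)) *
          (if t < h x then ENNReal.ofReal (h x) else 0)) ∂μ +
          B * ∫⁻ x, (∫⁻ t in Set.Ioi 0, ENNReal.ofReal (t ^ (p - 3)) *
          (if h x ≤ t then ENNReal.ofReal (h x ^ 2) else 0)) ∂μ := by
        rw [lintegral_add_left (m1.lintegral_prod_right'.const_mul A),
          lintegral_const_mul _ m1.lintegral_prod_right',
          lintegral_const_mul _ m2.lintegral_prod_right']
        congr 2
        · exact lintegral_lintegral_swap m1.aemeasurable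
        · exact lintegral_lintegral_swap m2.aemeasurable
    _ ≤ A * ∫⁻ x, ENNReal.ofReal (1 / (p - 1)) * ENNReal.ofReal (h x ^ p) ∂μ +
          B * ∫⁻ x, ENNReal.ofReal (1 / (2 - p)) * ENNReal.ofReal (h x ^ p) ∂μ := by
        gcongr with x x
        · exact lintegral_indicator_lt_rpow hp1 (h0 x)
        · exact lintegral_indicator_ge_rpow hp2 (h0 x)
    _ = _ := by
        rw [lintegral_const_mul' _ _ ENNReal.ofReal_ne_top,
          lintegral_const_mul' _ _ ENNReal.ofReal_ne_top]
        ring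

end RealInterpolation

section SplitInterpolation

variable {α β : Type*} [MeasurableSpace α] [MeasurableSpace β] {μ : Measure α} {ν : Measure β}

theorem lintegral_enorm_rpow_eq {μ : Measure α} (h : α → ℂ) {p : ℝ} (hp : 0 ≤ p) :
    ∫⁻ x, ENNReal.ofReal (‖h x‖ ^ p) ∂μ = ∫⁻ x, ‖h x‖ₑ ^ p ∂μ := by
  refine lintegral_congr fun x => ?_
  rw [← ENNReal.ofReal_rpow_of_nonneg (norm_nonneg _) hp, ofReal_norm]

/-- Real interpolation for an operator sending `h` to `u`, given for each height `t` a splitting of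
`u` into the image `a t` of the large part of `h`, and the image `b t` of its small part. -/
theorem lintegral_enorm_rpow_le_of_split [SFinite μ] {p : ℝ} (hp1 : 1 < p) (hp2 : p < 2)
    {h : α → ℂ} (hm : Measurable h) {u : β → ℂ} (um : AEMeasurable u ν) (A B : ℝ≥0∞)
    (a b : ℝ → β → ℂ) (hab : ∀ t, 0 < t → ∀ y, u y = a t y + b t y)
    (bm : ∀ t, 0 < t → AEMeasurable (b t) ν)
    (ha : ∀ t, 0 < t → ∀ s : ℝ, 0 < s → ν {y | s < ‖a t y‖} ≤
      A * ENNReal.ofReal s⁻¹ * ∫⁻ x, ‖{x | t < ‖h x‖}.indicator h x‖ₑ ∂μ)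
    (hb : ∀ t, 0 < t → ∫⁻ y, ‖b t y‖ₑ ^ 2 ∂ν ≤
      B * ∫⁻ x, ‖{x | ‖h x‖ ≤ t}.indicator h x‖ₑ ^ 2 ∂μ) :
    ∫⁻ y, ‖u y‖ₑ ^ p ∂ν ≤ ENNReal.ofReal p * (A * 2 * ENNReal.ofReal (1 / (p - 1)) +
      B * 4 * ENNReal.ofReal (1 / (2 - p))) * ∫⁻ x, ‖h x‖ₑ ^ p ∂μ := by
  rw [← lintegral_enorm_rpow_eq h (by linarith), ← lintegral_enorm_rpow_eq u (by linarith)]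
  refine lintegral_rpow_le_of_distribution_le hp1 hp2 hm.norm (fun _ => norm_nonneg _) um.norm
    (fun _ => norm_nonneg _) _ _ fun t ht => ?_
  have hlarge : ∫⁻ x, ‖{x | t < ‖h x‖}.indicator h x‖ₑ ∂μ =
      ∫⁻ x in {x | t < ‖h x‖}, ENNReal.ofReal ‖h x‖ ∂μ := by
    rw [← lintegral_indicator (measurableSet_lt measurable_const hm.norm)]
    refine lintegral_congr fun x => ?_
    by_cases hx : t < ‖h x‖ <;> simp [hx]
  have hsmall : ∫⁻ x, ‖{x | ‖h x‖ ≤ t}.indicator h x‖ₑ ^ 2 ∂μ =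
      ∫⁻ x in {x | ‖h x‖ ≤ t}, ENNReal.ofReal (‖h x‖ ^ 2) ∂μ := by
    rw [← lintegral_indicator (measurableSet_le hm.norm measurable_const)]
    refine lintegral_congr fun x => ?_
    by_cases hx : ‖h x‖ ≤ t <;> simp [hx, ENNReal.ofReal_pow]
  have hmarkov : ν {y | t / 2 ≤ ‖b t y‖} ≤
      ENNReal.ofReal ((t / 2)⁻¹ ^ 2) * ∫⁻ y, ‖b t y‖ₑ ^ 2 ∂ν := by
    have h1 := mul_meas_ge_le_lintegral₀ (((bm t ht).enorm.pow_const 2)) (ENNReal.ofReal ((t / 2) ^ 2))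
    have h2 : {y | ENNReal.ofReal ((t / 2) ^ 2) ≤ ‖b t y‖ₑ ^ 2} = {y | t / 2 ≤ ‖b t y‖} := by
      ext y
      simp only [Set.mem_ofPred_eq]
      rw [← ofReal_norm, ← ENNReal.ofReal_pow (norm_nonneg _),
        ENNReal.ofReal_le_ofReal_iff (by positivity), sq_le_sq₀ (by positivity) (norm_nonneg _)]
    rw [h2] at h1
    calc ν {y | t / 2 ≤ ‖b t y‖} = ENNReal.ofReal ((t / 2)⁻¹ ^ 2) *
          (ENNReal.ofReal ((t / 2) ^ 2) * ν {y | t / 2 ≤ ‖b t y‖}) := by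
          rw [← mul_assoc, ← ENNReal.ofReal_mul (by positivity), ← mul_pow,
            inv_mul_cancel₀ (by positivity)]
          simp
      _ ≤ _ := by gcongr
  calc ν {y | t < ‖u y‖} ≤ ν ({y | t / 2 < ‖a t y‖} ∪ {y | t / 2 ≤ ‖b t y‖}) := by
        refine measure_mono fun y hy => ?_
        simp only [Set.mem_ofPred_eq, Set.mem_union] at hy ⊢
        by_contra! hcon
        have := norm_add_le (a t y) (b t y)
        rw [← hab t ht] at this
        linarith
    _ ≤ ν {y | t / 2 < ‖a t y‖} + ν {y | t / 2 ≤ ‖b t y‖} := measure_union_le _ _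
    _ ≤ A * ENNReal.ofReal (t / 2)⁻¹ * ∫⁻ x, ‖{x | t < ‖h x‖}.indicator h x‖ₑ ∂μ +
        ENNReal.ofReal ((t / 2)⁻¹ ^ 2) *
          (B * ∫⁻ x, ‖{x | ‖h x‖ ≤ t}.indicator h x‖ₑ ^ 2 ∂μ) := by
        gcongr
        · exact ha t ht _ (by positivity)
        · exact hmarkov.trans (by gcongr; exact hb t ht)
    _ = _ := by
        rw [hlarge, hsmall, show (t / 2)⁻¹ = 2 * t⁻¹ by field_simp, mul_pow,
          ENNReal.ofReal_mul (by norm_num), ENNReal.ofReal_mul (by norm_num)]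
        norm_num
        ring

end SplitInterpolation

section GaussianKernel

variable {E : Type*} [NormedAddCommGroup E] [InnerProductSpace ℝ E]

/-- The time-frequency shifted Gaussian, damped by the symbol `e^{-s|η|²}` of the heat semigroup. -/
def heatAtom (s : ℝ) (x ξ η : E) : ℂ :=
  Complex.exp (((-s * ‖η‖ ^ 2 - π * ‖η - ξ‖ ^ 2 : ℝ) : ℂ) + 2 * π * Complex.I * ⟪x, η⟫)

theorem norm_heatAtom (s : ℝ) (x ξ η : E) :
    ‖heatAtom s x ξ η‖ = rexp (-s * ‖η‖ ^ 2 - π * ‖η - ξ‖ ^ 2) := by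
  simp [heatAtom, Complex.norm_exp, -Complex.ofReal_pow]

theorem heatAtom_eq (s : ℝ) (x ξ η : E) :
    heatAtom s x ξ η = (rexp (-s * ‖η‖ ^ 2) : ℝ) * heatAtom 0 x ξ η := by
  simp only [heatAtom, Complex.ofReal_exp, ← Complex.exp_add]
  congr 1
  push_cast
  ring

@[fun_prop]
theorem continuous_heatAtom {X : Type*} [TopologicalSpace X] {s : X → ℝ} {x ξ η : X → E}
    (hs : Continuous s) (hx : Continuous x) (hξ : Continuous ξ) (hη : Continuous η) :
    Continuous fun z => heatAtom (s z) (x z) (ξ z) (η z) := by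
  unfold heatAtom
  fun_prop

theorem norm_heatAtom_le {s : ℝ} (hs : 0 ≤ s) (x ξ η : E) :
    ‖heatAtom s x ξ η‖ ≤ rexp (-π * ‖η - ξ‖ ^ 2) := by
  rw [norm_heatAtom]
  gcongr
  nlinarith [mul_nonneg hs (sq_nonneg ‖η‖)]

/-- Completing the square in the Gaussian of `heatAtom`. -/
theorem heatAtom_eq_shift {s : ℝ} (hs : 0 ≤ s) (x ξ η : E) :
    heatAtom s x ξ η = (rexp (-(π * s / (π + s)) * ‖ξ‖ ^ 2) : ℝ) *
      Complex.exp (2 * π * Complex.I * ⟪x, (π / (π + s)) • ξ⟫) *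
      Complex.exp (-((π + s : ℝ) : ℂ) * ‖η + -((π / (π + s)) • ξ)‖ ^ 2 +
        2 * π * Complex.I * ⟪x, η + -((π / (π + s)) • ξ)⟫) := by
  have hb : 0 < π + s := by positivity
  simp only [heatAtom, Complex.ofReal_exp, ← Complex.exp_add]
  congr 1
  rw [inner_add_right, inner_neg_right]
  have key : -s * ‖η‖ ^ 2 - π * ‖η - ξ‖ ^ 2 = -(π * s / (π + s)) * ‖ξ‖ ^ 2 +
      -(π + s) * ‖η + -((π / (π + s)) • ξ)‖ ^ 2 := by
    rw [← sub_eq_add_neg, norm_sub_sq_real, norm_sub_sq_real, inner_smul_right, norm_smul,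
      Real.norm_of_nonneg (by positivity)]
    field_simp
    ring
  rw [key]
  push_cast
  ring

variable [FiniteDimensional ℝ E] [MeasurableSpace E] [BorelSpace E]

theorem integrable_exp_neg_mul_norm_sq {b : ℝ} (hb : 0 < b) :
    Integrable fun v : E => rexp (-b * ‖v‖ ^ 2) := by
  have := (GaussianFourier.integrable_cexp_neg_mul_sq_norm_add (V := E) (b := b)
    (by simpa using hb) 0 0).norm
  refine this.congr (.of_forall fun v => ?_)
  simp [Complex.norm_exp, ← Complex.ofReal_pow]

theorem integrable_exp_neg_pi_mul_norm_sub_sq (ξ : E) :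
    Integrable fun v : E => rexp (-π * ‖v - ξ‖ ^ 2) :=
  (integrable_exp_neg_mul_norm_sq pi_pos).comp_sub_right ξ

theorem integrable_heatAtom {s : ℝ} (hs : 0 ≤ s) (x ξ : E) : Integrable (heatAtom s x ξ) := by
  refine (integrable_exp_neg_pi_mul_norm_sub_sq ξ).mono' ?_ (.of_forall fun η => ?_)
  · exact (by fun_prop : Continuous fun η => heatAtom s x ξ η).aestronglyMeasurable
  · exact norm_heatAtom_le hs x ξ η

theorem fourier_heatAtom {s : ℝ} (hs : 0 ≤ s) (x ξ y : E) :
    𝓕 (heatAtom s x ξ) y = (rexp (-(π * s / (π + s)) * ‖ξ‖ ^ 2) : ℝ) *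
      Complex.exp (2 * π * Complex.I * ⟪x - y, (π / (π + s)) • ξ⟫) *
      ((π / (π + s) : ℂ) ^ (Module.finrank ℝ E / 2 : ℂ) *
        Complex.exp (-π ^ 2 * ‖x - y‖ ^ 2 / (π + s))) := by
  have hb : 0 < π + s := by positivity
  set m : E := (π / (π + s)) • ξ with hm
  set c : ℂ := (rexp (-(π * s / (π + s)) * ‖ξ‖ ^ 2) : ℝ) *
      Complex.exp (2 * π * Complex.I * ⟪x, m⟫) with hc
  set v : E → ℂ := fun η => Complex.exp (-((π + s : ℝ) : ℂ) * ‖η‖ ^ 2 +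
        2 * π * Complex.I * ⟪x, η⟫) with hv
  have h1 : heatAtom s x ξ = c • (v ∘ fun η => η + -m) := by
    ext η
    simp only [heatAtom_eq_shift hs, Pi.smul_apply, Function.comp, smul_eq_mul, hc, hv, hm]
  have h2 : 𝓕 (v ∘ fun η => η + -m) y = Real.fourierChar (-⟪m, y⟫) • 𝓕 v y := by
    have := congrFun (VectorFourier.fourierIntegral_comp_add_right Real.fourierChar
      (volume : Measure E) (innerₗ E) v (-m)) y
    simpa using! this
  have h3 : 𝓕 (c • (v ∘ fun η => η + -m)) y = c • 𝓕 (v ∘ fun η => η + -m) y :=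
    congrFun (VectorFourier.fourierIntegral_const_smul Real.fourierChar
      (volume : Measure E) (innerₗ E) (v ∘ fun η => η + -m) c) y
  rw [h1, h3, h2, hv, fourier_gaussian_innerProductSpace' (by simpa using hb), Circle.smul_def,
    Real.fourierChar_apply, hc, inner_sub_left, real_inner_comm y m]
  simp only [smul_eq_mul, Complex.ofReal_add]
  have e : Complex.exp (2 * π * Complex.I * ((⟪x, m⟫ - ⟪y, m⟫ : ℝ) : ℂ)) =
      Complex.exp (2 * π * Complex.I * ⟪x, m⟫) *
        Complex.exp (((2 * π * -⟪y, m⟫ : ℝ) : ℂ) * Complex.I) := by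
    rw [← Complex.exp_add]
    congr 1
    push_cast
    ring
  rw [e]
  ring

theorem fourier_heatAtom_zero (x ξ y : E) :
    𝓕 (heatAtom 0 x ξ) y = Complex.exp (2 * π * Complex.I * ⟪x - y, ξ⟫) *
        (rexp (-π * ‖y - x‖ ^ 2) : ℝ) := by
  have hpi : (π : ℂ) ≠ 0 := by exact_mod_cast pi_ne_zero
  rw [fourier_heatAtom le_rfl]
  simp only [add_zero, Complex.ofReal_zero, div_self hpi, div_self pi_ne_zero, one_smul,
    Complex.one_cpow, one_mul, mul_zero, zero_div, neg_zero, zero_mul, Real.exp_zero,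
    Complex.ofReal_one, norm_sub_rev x y]
  congr 1
  push_cast
  congr 1
  field_simp

theorem norm_fourier_heatAtom_le {s : ℝ} (hs : 0 ≤ s) (x ξ y : E) :
    ‖𝓕 (heatAtom s x ξ) y‖ ≤ rexp (-(π * s / (π + s)) * ‖ξ‖ ^ 2) *
      rexp (-π ^ 2 * ‖x - y‖ ^ 2 / (π + s)) := by
  have hb : 0 < π + s := by positivity
  rw [fourier_heatAtom hs, norm_mul, norm_mul, norm_mul, Complex.norm_real,
    Real.norm_of_nonneg (Real.exp_pos _).le]
  have e1 : ‖Complex.exp (2 * π * Complex.I * ⟪x - y, (π / (π + s)) • ξ⟫)‖ = 1 := by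
    simp [Complex.norm_exp]
  have e2 : ‖Complex.exp (-π ^ 2 * ‖x - y‖ ^ 2 / (π + s))‖ =
      rexp (-π ^ 2 * ‖x - y‖ ^ 2 / (π + s)) := by
    rw [show (-π ^ 2 * ‖x - y‖ ^ 2 / (π + s) : ℂ) =
      ((-π ^ 2 * ‖x - y‖ ^ 2 / (π + s) : ℝ) : ℂ) by push_cast; rfl, Complex.norm_exp_ofReal]
  have e3 : ‖(π / (π + s) : ℂ) ^ (Module.finrank ℝ E / 2 : ℂ)‖ ≤ 1 := by
    rw [show (π / (π + s) : ℂ) = ((π / (π + s) : ℝ) : ℂ) by push_cast; rfl,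
      Complex.norm_cpow_eq_rpow_re_of_pos (by positivity)]
    refine Real.rpow_le_one (by positivity) ((div_le_one hb).2 (by linarith)) ?_
    rw [show (Module.finrank ℝ E / 2 : ℂ) = ((Module.finrank ℝ E / 2 : ℝ) : ℂ) by push_cast; rfl,
      Complex.ofReal_re]
    positivity
  rw [e1, e2, mul_one]
  gcongr
  exact mul_le_of_le_one_left (Real.exp_pos _).le e3

end GaussianKernel

section DecayWeight

variable {E : Type*} [NormedAddCommGroup E] [InnerProductSpace ℝ E]

/-- An integrable polynomial weight on `E`. -/
def decayWeight (x : E) : ℝ := ((1 + ‖x‖) ^ (Module.finrank ℝ E + 1))⁻¹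

theorem decayWeight_pos (x : E) : 0 < decayWeight x := by
  unfold decayWeight; positivity

@[fun_prop]
theorem continuous_decayWeight : Continuous (decayWeight : E → ℝ) := by
  unfold decayWeight
  exact Continuous.inv₀ (by fun_prop) fun x => by positivity

theorem one_add_pow_mul_exp_neg_le (N : ℕ) {r : ℝ} (hr : 0 ≤ r) :
    (1 + r) ^ N * rexp (-π * r ^ 2) ≤ N.factorial * rexp 2 * rexp (-1 * r ^ 2) := by
  have h1 : (1 + r) ^ N ≤ N.factorial * rexp (1 + r) := by
    have := Real.pow_div_factorial_le_exp (1 + r) (by positivity) N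
    rwa [div_le_iff₀' (by positivity)] at this
  calc (1 + r) ^ N * rexp (-π * r ^ 2) ≤ N.factorial * rexp (1 + r) * rexp (-π * r ^ 2) := by gcongr
    _ = N.factorial * rexp (1 + r + -π * r ^ 2) := by rw [mul_assoc, ← Real.exp_add]
    _ ≤ N.factorial * rexp (2 + -1 * r ^ 2) := by
        gcongr ?_ * rexp ?_
        nlinarith [pi_gt_three, sq_nonneg r, mul_nonneg (sub_nonneg.2 pi_gt_three.le) (sq_nonneg r),
          sq_nonneg (2 * r - 1)]
    _ = _ := by rw [Real.exp_add]; ring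

variable [FiniteDimensional ℝ E] [MeasurableSpace E] [BorelSpace E]

theorem integrable_decayWeight : Integrable (decayWeight : E → ℝ) := by
  have := integrable_one_add_norm (E := E) (μ := volume) (r := Module.finrank ℝ E + 1) (by simp)
  refine this.congr (.of_forall fun x => ?_)
  simp only [decayWeight]
  rw [Real.rpow_neg (by positivity)]
  norm_cast

theorem integrable_one_add_pow_mul_exp (N : ℕ) :
    Integrable fun v : E => (1 + ‖v‖) ^ N * rexp (-π * ‖v‖ ^ 2) := by
  refine ((integrable_exp_neg_mul_norm_sq one_pos).const_mul (N.factorial * rexp 2)).mono'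
    (by fun_prop) (.of_forall fun v => ?_)
  rw [Real.norm_of_nonneg (by positivity)]
  exact one_add_pow_mul_exp_neg_le N (norm_nonneg v)

theorem exists_gaussian_average_le (φ : 𝓢(E, ℂ)) : ∃ C : ℝ, 0 ≤ C ∧ ∀ x : E,
    ∫ t, ‖φ t‖ * rexp (-π * ‖t - x‖ ^ 2) ≤ C * decayWeight x ^ 2 := by
  set N := 2 * (Module.finrank ℝ E + 1) with hN
  obtain ⟨C₁, hC₁⟩ : ∃ C₁ : ℝ, ∀ t, (1 + ‖t‖) ^ N * ‖φ t‖ ≤ C₁ := by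
    have H := SchwartzMap.one_add_le_sup_seminorm_apply (𝕜 := ℝ) (m := (N, 0)) le_rfl le_rfl φ
    exact ⟨_, fun t => by simpa only [norm_iteratedFDeriv_zero] using H t⟩
  have hC₁0 : 0 ≤ C₁ := le_trans (by positivity) (hC₁ 0)
  refine ⟨C₁ * ∫ v : E, (1 + ‖v‖) ^ N * rexp (-π * ‖v‖ ^ 2), ?_, fun x => ?_⟩
  · exact mul_nonneg hC₁0 (integral_nonneg fun v => by positivity)
  have hw : decayWeight x ^ 2 = ((1 + ‖x‖) ^ N)⁻¹ := by
    rw [decayWeight, inv_pow, ← pow_mul, hN, mul_comm]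
  have hint := (integrable_one_add_pow_mul_exp (E := E) N).comp_sub_right x
  rw [← integral_sub_right_eq_self (fun v : E => (1 + ‖v‖) ^ N * rexp (-π * ‖v‖ ^ 2)) x, hw, ← integral_const_mul, ← integral_mul_const]
  refine integral_mono_of_nonneg (.of_forall fun t => by positivity)
    ((hint.const_mul C₁).mul_const _) (.of_forall fun t => ?_)
  have h1 : 1 + ‖x‖ ≤ (1 + ‖t‖) * (1 + ‖t - x‖) := by
    have := norm_sub_norm_le x t
    rw [norm_sub_rev x t] at this
    nlinarith [mul_nonneg (norm_nonneg t) (norm_nonneg (t - x))]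
  have h2 : (1 + ‖x‖) ^ N ≤ (1 + ‖t‖) ^ N * (1 + ‖t - x‖) ^ N := by
    rw [← mul_pow]; gcongr
  simp only
  rw [← div_eq_mul_inv, le_div_iff₀ (by positivity)]
  calc ‖φ t‖ * rexp (-π * ‖t - x‖ ^ 2) * (1 + ‖x‖) ^ N
      ≤ ‖φ t‖ * rexp (-π * ‖t - x‖ ^ 2) * ((1 + ‖t‖) ^ N * (1 + ‖t - x‖) ^ N) := by gcongr
    _ = ((1 + ‖t‖) ^ N * ‖φ t‖) * ((1 + ‖t - x‖) ^ N * rexp (-π * ‖t - x‖ ^ 2)) := by ring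
    _ ≤ _ := by gcongr; exact hC₁ t

end DecayWeight

section STFT

variable {d : ℕ}

theorem FT_eq_fourier (f : EuclideanSpace ℝ (Fin d) → ℂ) : FT f = 𝓕 f := by
  ext ξ
  rw [FT, Real.fourier_eq']
  refine integral_congr_ae (.of_forall fun x => ?_)
  simp only [smul_eq_mul, real_inner_comm x ξ]
  push_cast
  ring_nf

theorem IFT_eq_fourierInv (f : EuclideanSpace ℝ (Fin d) → ℂ) : IFT f = 𝓕⁻ f := by
  ext ξ
  rw [IFT, Real.fourierInv_eq']
  refine integral_congr_ae (.of_forall fun x => ?_)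
  simp only [smul_eq_mul, real_inner_comm x ξ]

@[fun_prop]
theorem continuous_gaussWindow : Continuous (gaussWindow : EuclideanSpace ℝ (Fin d) → ℂ) := by
  unfold gaussWindow
  fun_prop

theorem norm_gaussWindow (t : EuclideanSpace ℝ (Fin d)) :
    ‖gaussWindow t‖ = rexp (-π * ‖t‖ ^ 2) := by
  rw [gaussWindow, Complex.norm_real, Real.norm_of_nonneg (Real.exp_pos _).le]

theorem norm_gaussWindow_le_one (t : EuclideanSpace ℝ (Fin d)) : ‖gaussWindow t‖ ≤ 1 := by
  rw [norm_gaussWindow]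
  exact Real.exp_le_one_iff.2 (by nlinarith [pi_pos, mul_nonneg pi_pos.le (sq_nonneg ‖t‖)])

theorem STFT_eq_fourier (f : EuclideanSpace ℝ (Fin d) → ℂ) (x : EuclideanSpace ℝ (Fin d)) :
    STFT f x = 𝓕 fun t => f t * gaussWindow (t - x) := by
  rw [← FT_eq_fourier]
  ext ξ
  simp only [STFT, FT, mul_assoc]

theorem integrable_mul_gaussWindow {f : EuclideanSpace ℝ (Fin d) → ℂ} (hf : Integrable f)
    (x : EuclideanSpace ℝ (Fin d)) : Integrable fun t => f t * gaussWindow (t - x) :=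
  hf.mul_bdd (c := 1) (by fun_prop) (.of_forall fun _ => norm_gaussWindow_le_one _)

theorem STFT_eq_integral_heatAtom {f : EuclideanSpace ℝ (Fin d) → ℂ} (hf : Integrable f)
    (x ξ : EuclideanSpace ℝ (Fin d)) : STFT f x ξ =
      Complex.exp (-(2 * π * Complex.I * ⟪x, ξ⟫)) * ∫ η, 𝓕 f η * heatAtom 0 x ξ η := by
  rw [integral_fourier_mul_eq_of_integrable hf (integrable_heatAtom le_rfl x ξ),
    ← integral_const_mul, STFT]
  refine integral_congr_ae (.of_forall fun t => ?_)
  simp only [fourier_heatAtom_zero, gaussWindow, inner_sub_left]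
  rw [show Complex.exp (-((2 * π * ⟪ξ, t⟫ : ℝ) * Complex.I)) =
    Complex.exp (-(2 * π * Complex.I * ⟪x, ξ⟫)) *
      Complex.exp (2 * π * Complex.I * ((⟪x, ξ⟫ - ⟪t, ξ⟫ : ℝ) : ℂ)) by
    rw [← Complex.exp_add, real_inner_comm ξ t]; push_cast; ring_nf]
  ring

theorem norm_STFT_eq {f : EuclideanSpace ℝ (Fin d) → ℂ} (hf : Integrable f)
    (x ξ : EuclideanSpace ℝ (Fin d)) : ‖STFT f x ξ‖ = ‖∫ η, 𝓕 f η * heatAtom 0 x ξ η‖ := by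
  rw [STFT_eq_integral_heatAtom hf, norm_mul]
  simp [Complex.norm_exp]

theorem continuous_STFT {f : EuclideanSpace ℝ (Fin d) → ℂ} (hf : Continuous f)
    (hi : Integrable f) :
    Continuous fun z : EuclideanSpace ℝ (Fin d) × EuclideanSpace ℝ (Fin d) =>
      STFT f z.1 z.2 := by
  refine continuous_of_dominated (bound := fun t => ‖f t‖) (fun z => ?_)
    (fun z => .of_forall fun t => ?_) hi.norm (.of_forall fun t => ?_)
  · exact Continuous.aestronglyMeasurable (by fun_prop)
  · rw [norm_mul, norm_mul]
    have h1 : ‖Complex.exp (-(((2 * π * ⟪z.2, t⟫ : ℝ) : ℂ) * Complex.I))‖ = 1 := by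
      simp [Complex.norm_exp]
    rw [h1, one_mul]
    exact mul_le_of_le_one_right (norm_nonneg _) (norm_gaussWindow_le_one _)
  · fun_prop

theorem exists_norm_STFT_le (f : 𝓢(EuclideanSpace ℝ (Fin d), ℂ)) : ∃ C : ℝ, 0 ≤ C ∧
    ∀ x ξ, ‖STFT (fun t => f t) x ξ‖ ≤ C * decayWeight x * decayWeight ξ := by
  obtain ⟨C₁, h₁, hC₁⟩ := exists_gaussian_average_le f
  obtain ⟨C₂, h₂, hC₂⟩ := exists_gaussian_average_le (𝓕 f)
  refine ⟨max C₁ C₂, le_max_of_le_left h₁, fun x ξ => ?_⟩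
  have b₁ : ‖STFT (fun t => f t) x ξ‖ ≤ max C₁ C₂ * decayWeight x ^ 2 := by
    rw [STFT_eq_fourier]
    refine (norm_fourier_le_integral_norm _ _).trans ?_
    simp only [norm_mul, norm_gaussWindow]
    exact (hC₁ x).trans (by gcongr; exact le_max_left _ _)
  have b₂ : ‖STFT (fun t => f t) x ξ‖ ≤ max C₁ C₂ * decayWeight ξ ^ 2 := by
    rw [norm_STFT_eq f.integrable]
    refine (norm_integral_le_integral_norm _).trans ?_
    have e (η : EuclideanSpace ℝ (Fin d)) : ‖𝓕 (fun t => f t) η * heatAtom 0 x ξ η‖ =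
        ‖(𝓕 f) η‖ * rexp (-π * ‖η - ξ‖ ^ 2) := by
      rw [norm_mul, norm_heatAtom, SchwartzMap.fourier_coe]
      simp
    simp only [e]
    exact (hC₂ ξ).trans (by gcongr; exact le_max_right _ _)
  have hx := decayWeight_pos x
  have hξ := decayWeight_pos ξ
  have hm : 0 ≤ max C₁ C₂ := le_max_of_le_left h₁
  refine le_of_sq_le_sq ?_ (by positivity)
  calc ‖STFT (fun t => f t) x ξ‖ ^ 2 = ‖STFT (fun t => f t) x ξ‖ * ‖STFT (fun t => f t) x ξ‖ := sq _
    _ ≤ (max C₁ C₂ * decayWeight x ^ 2) * (max C₁ C₂ * decayWeight ξ ^ 2) := by gcongr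
    _ = _ := by ring

end STFT

section CauchySchwarz

variable {α : Type*} [MeasurableSpace α] {μ : Measure α}

theorem sq_lintegral_mul_le {f g : α → ℝ≥0∞} (hf : AEMeasurable f μ) (hg : AEMeasurable g μ) :
    (∫⁻ x, f x * g x ∂μ) ^ 2 ≤ (∫⁻ x, f x ^ 2 ∂μ) * ∫⁻ x, g x ^ 2 ∂μ := by
  have h := ENNReal.lintegral_mul_le_Lp_mul_Lq μ Real.HolderConjugate.two_two hf hg
  simp only [Pi.mul_apply, ENNReal.rpow_two] at h
  calc (∫⁻ x, f x * g x ∂μ) ^ 2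
      ≤ ((∫⁻ x, f x ^ 2 ∂μ) ^ (1 / 2 : ℝ) * (∫⁻ x, g x ^ 2 ∂μ) ^ (1 / 2 : ℝ)) ^ 2 := by gcongr
    _ = _ := by
        rw [mul_pow, ← ENNReal.rpow_natCast, ← ENNReal.rpow_natCast, ← ENNReal.rpow_mul,
          ← ENNReal.rpow_mul]
        norm_num

theorem memLp_two_of_bounded {u : α → ℂ} (hu : Integrable u μ) (M : ℝ) (hM : ∀ x, ‖u x‖ ≤ M) :
    MemLp u 2 μ := by
  rw [memLp_two_iff_integrable_sq_norm hu.aestronglyMeasurable]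
  have := hu.norm.bdd_mul (c := M) hu.norm.aestronglyMeasurable
    (.of_forall fun x => by simpa using hM x)
  simpa only [sq] using this

end CauchySchwarz

section Synthesis

variable {d : ℕ}

/-- The adjoint of the short-time Fourier transform. -/
def synthesis (F : EuclideanSpace ℝ (Fin d) × EuclideanSpace ℝ (Fin d) → ℂ)
    (t : EuclideanSpace ℝ (Fin d)) : ℂ :=
  ∫ x, gaussWindow (t - x) * 𝓕⁻ (fun ξ => F (x, ξ)) t

/-- Measurable functions on phase space dominated by an integrable product weight. -/
def IsDecaying (F : EuclideanSpace ℝ (Fin d) × EuclideanSpace ℝ (Fin d) → ℂ) : Prop :=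
  Measurable F ∧ ∃ C : ℝ, 0 ≤ C ∧ ∀ x ξ, ‖F (x, ξ)‖ ≤ C * decayWeight x * decayWeight ξ

variable {F G : EuclideanSpace ℝ (Fin d) × EuclideanSpace ℝ (Fin d) → ℂ}

theorem IsDecaying.indicator (hF : IsDecaying F)
    {s : Set (EuclideanSpace ℝ (Fin d) × EuclideanSpace ℝ (Fin d))} (hs : MeasurableSet s) :
    IsDecaying (s.indicator F) := by
  obtain ⟨hm, C, hC, h⟩ := hF
  exact ⟨hm.indicator hs, C, hC, fun x ξ => (norm_indicator_le_norm_self _ _).trans (h x ξ)⟩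

theorem IsDecaying.integrable_slice (hF : IsDecaying F) (x : EuclideanSpace ℝ (Fin d)) :
    Integrable fun ξ => F (x, ξ) := by
  obtain ⟨hm, C, hC, h⟩ := hF
  exact (integrable_decayWeight.const_mul (C * decayWeight x)).mono'
    (hm.comp measurable_prodMk_left).aestronglyMeasurable (.of_forall fun ξ => h x ξ)

theorem decayWeight_le_one {E : Type*} [NormedAddCommGroup E] [InnerProductSpace ℝ E] (x : E) :
    decayWeight x ≤ 1 :=
  inv_le_one_of_one_le₀ (one_le_pow₀ (by linarith [norm_nonneg x]))

theorem IsDecaying.memLp_two_slice (hF : IsDecaying F) (x : EuclideanSpace ℝ (Fin d)) :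
    MemLp (fun ξ => F (x, ξ)) 2 := by
  obtain ⟨C, hC, h⟩ := hF.2
  refine memLp_two_of_bounded (hF.integrable_slice x) (C * decayWeight x) fun ξ => ?_
  refine (h x ξ).trans (mul_le_of_le_one_right ?_ (decayWeight_le_one ξ))
  exact mul_nonneg hC (decayWeight_pos x).le

theorem norm_fourierInv_le_integral_norm {E : Type*} [NormedAddCommGroup E]
    [InnerProductSpace ℝ E] [FiniteDimensional ℝ E] [MeasurableSpace E] [BorelSpace E]
    (u : E → ℂ) (ξ : E) : ‖𝓕⁻ u ξ‖ ≤ ∫ x, ‖u x‖ := by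
  rw [Real.fourierInv_eq_fourier_neg]
  exact norm_fourier_le_integral_norm u _

theorem stronglyMeasurable_fourierInv_slice (hm : Measurable F) {α : Type*} [MeasurableSpace α]
    {x t : α → EuclideanSpace ℝ (Fin d)} (hx : Measurable x) (ht : Measurable t) :
    StronglyMeasurable fun a => 𝓕⁻ (fun ξ => F (x a, ξ)) (t a) := by
  have h : Measurable fun q : α × EuclideanSpace ℝ (Fin d) =>
      Complex.exp ((2 * π * ⟪q.2, t q.1⟫ : ℝ) * Complex.I) • F (x q.1, q.2) := by
    have := hm.comp ((hx.comp measurable_fst).prodMk (measurable_snd (α := α)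
      (β := EuclideanSpace ℝ (Fin d))))
    simp only [Function.comp_def] at this
    fun_prop
  simp only [Real.fourierInv_eq']
  exact h.stronglyMeasurable.integral_prod_right'

theorem IsDecaying.integrable_synthesis (hF : IsDecaying F) (t : EuclideanSpace ℝ (Fin d)) :
    Integrable fun x => gaussWindow (t - x) * 𝓕⁻ (fun ξ => F (x, ξ)) t := by
  obtain ⟨C, hC, h⟩ := hF.2
  refine Integrable.bdd_mul (c := 1) ?_
    (Continuous.aestronglyMeasurable (by fun_prop)) (.of_forall fun x => norm_gaussWindow_le_one _)
  refine (integrable_decayWeight.const_mul (C * ∫ ξ : EuclideanSpace ℝ (Fin d), decayWeight ξ)).mono'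
    (stronglyMeasurable_fourierInv_slice hF.1 measurable_id measurable_const).aestronglyMeasurable (.of_forall fun x => ?_)
  refine (norm_fourierInv_le_integral_norm _ _).trans ?_
  calc ∫ ξ, ‖F (x, ξ)‖ ≤ ∫ ξ, C * decayWeight x * decayWeight ξ :=
        integral_mono (hF.integrable_slice x).norm (integrable_decayWeight.const_mul _) (h x)
    _ = _ := by rw [integral_const_mul]; ring

theorem fourierInv_add_of_integrable {E : Type*} [NormedAddCommGroup E]
    [InnerProductSpace ℝ E] [FiniteDimensional ℝ E] [MeasurableSpace E] [BorelSpace E]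
    {u v : E → ℂ} (hu : Integrable u) (hv : Integrable v) (t : E) :
    𝓕⁻ (fun ξ => u ξ + v ξ) t = 𝓕⁻ u t + 𝓕⁻ v t := by
  simp only [Real.fourierInv_eq_fourier_neg]
  exact congrFun (VectorFourier.fourierIntegral_add continuous_fourierChar (L := innerₗ E)
    continuous_inner hu hv) (-t)

theorem IsDecaying.synthesis_add (hF : IsDecaying F) (hG : IsDecaying G)
    (t : EuclideanSpace ℝ (Fin d)) :
    synthesis (F + G) t = synthesis F t + synthesis G t := by
  rw [synthesis, synthesis, synthesis,
    ← integral_add (hF.integrable_synthesis t) (hG.integrable_synthesis t)]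
  refine integral_congr_ae (.of_forall fun x => ?_)
  simp only [Pi.add_apply]
  rw [fourierInv_add_of_integrable (hF.integrable_slice x) (hG.integrable_slice x), mul_add]

theorem stronglyMeasurable_synthesis (hm : Measurable F) : StronglyMeasurable (synthesis F) := by
  have h : StronglyMeasurable fun z : EuclideanSpace ℝ (Fin d) × EuclideanSpace ℝ (Fin d) =>
      gaussWindow (z.1 - z.2) * 𝓕⁻ (fun ξ => F (z.2, ξ)) z.1 := by
    refine StronglyMeasurable.mul ?_ ?_
    · exact Continuous.stronglyMeasurable (by fun_prop)
    · exact stronglyMeasurable_fourierInv_slice hm measurable_snd measurable_fst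
  exact h.integral_prod_right'

theorem enorm_fourierInv_le {E : Type*} [NormedAddCommGroup E]
    [InnerProductSpace ℝ E] [FiniteDimensional ℝ E] [MeasurableSpace E] [BorelSpace E]
    (u : E → ℂ) (t : E) : ‖𝓕⁻ u t‖ₑ ≤ ∫⁻ ξ, ‖u ξ‖ₑ := by
  rw [Real.fourierInv_eq']
  refine (enorm_integral_le_lintegral_enorm _).trans_eq (lintegral_congr fun ξ => ?_)
  rw [← ofReal_norm, norm_smul, ← ofReal_norm, Complex.norm_exp_ofReal_mul_I, one_mul]

theorem lintegral_enorm_synthesis_le (hm : Measurable F) : ∫⁻ t, ‖synthesis F t‖ₑ ≤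
    (∫⁻ t : EuclideanSpace ℝ (Fin d), ‖gaussWindow t‖ₑ) * ∫⁻ z, ‖F z‖ₑ := by
  calc ∫⁻ t, ‖synthesis F t‖ₑ
      ≤ ∫⁻ t, ∫⁻ x, ‖gaussWindow (t - x)‖ₑ * ∫⁻ ξ, ‖F (x, ξ)‖ₑ := by
        gcongr with t
        refine (enorm_integral_le_lintegral_enorm _).trans (lintegral_mono fun x => ?_)
        rw [enorm_mul]
        gcongr
        exact enorm_fourierInv_le _ _
    _ = ∫⁻ x, ∫⁻ t, ‖gaussWindow (t - x)‖ₑ * ∫⁻ ξ, ‖F (x, ξ)‖ₑ := by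
        refine lintegral_lintegral_swap (Measurable.aemeasurable ?_)
        refine Measurable.mul (Continuous.measurable (by fun_prop)) ?_
        exact (hm.enorm.lintegral_prod_right' (ν := volume)).comp measurable_snd
    _ = ∫⁻ x, (∫⁻ t : EuclideanSpace ℝ (Fin d), ‖gaussWindow t‖ₑ) * ∫⁻ ξ, ‖F (x, ξ)‖ₑ := by
        refine lintegral_congr fun x => ?_
        rw [lintegral_mul_const _ (Continuous.measurable (by fun_prop)),
          lintegral_sub_right_eq_self (fun t => ‖gaussWindow t‖ₑ) x]
    _ = _ := by
        rw [lintegral_const_mul _ (hm.enorm.lintegral_prod_right' (ν := volume)),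
          Measure.volume_eq_prod, lintegral_prod _ hm.enorm.aemeasurable]

theorem IsDecaying.lintegral_enorm_synthesis_sq_le (hF : IsDecaying F) :
    ∫⁻ t, ‖synthesis F t‖ₑ ^ 2 ≤
      (∫⁻ t : EuclideanSpace ℝ (Fin d), ‖gaussWindow t‖ₑ ^ 2) * ∫⁻ z, ‖F z‖ₑ ^ 2 := by
  have hg : Measurable fun t : EuclideanSpace ℝ (Fin d) => ‖gaussWindow t‖ₑ :=
    Continuous.measurable (by fun_prop)
  calc ∫⁻ t, ‖synthesis F t‖ₑ ^ 2
      ≤ ∫⁻ t, (∫⁻ x : EuclideanSpace ℝ (Fin d), ‖gaussWindow x‖ₑ ^ 2) *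
          ∫⁻ x, ‖𝓕⁻ (fun ξ => F (x, ξ)) t‖ₑ ^ 2 := by
        gcongr with t
        rw [← lintegral_sub_left_eq_self (fun x => ‖gaussWindow x‖ₑ ^ 2) t]
        refine le_trans ?_ (sq_lintegral_mul_le (hg.comp (by fun_prop)).aemeasurable
          (stronglyMeasurable_fourierInv_slice hF.1 measurable_id
            measurable_const).measurable.enorm.aemeasurable)
        gcongr
        refine (enorm_integral_le_lintegral_enorm _).trans_eq (lintegral_congr fun x => ?_)
        rw [enorm_mul]
    _ = (∫⁻ x : EuclideanSpace ℝ (Fin d), ‖gaussWindow x‖ₑ ^ 2) *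
          ∫⁻ x, ∫⁻ t, ‖𝓕⁻ (fun ξ => F (x, ξ)) t‖ₑ ^ 2 := by
        rw [lintegral_const_mul]
        · congr 1
          refine lintegral_lintegral_swap (Measurable.aemeasurable ?_)
          exact (stronglyMeasurable_fourierInv_slice hF.1 measurable_snd
            measurable_fst).measurable.enorm.pow_const 2
        · exact ((stronglyMeasurable_fourierInv_slice hF.1 measurable_snd
            measurable_fst).measurable.enorm.pow_const 2).lintegral_prod_right' (ν := volume)
    _ = _ := by
        rw [Measure.volume_eq_prod, lintegral_prod _ (hF.1.enorm.pow_const 2).aemeasurable]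
        congr 1
        refine lintegral_congr fun x => ?_
        rw [lintegral_fourierInv_sq_eq (hF.integrable_slice x) (hF.memLp_two_slice x)]

theorem isDecaying_STFT (f : 𝓢(EuclideanSpace ℝ (Fin d), ℂ)) :
    IsDecaying fun z => STFT (fun t => f t) z.1 z.2 :=
  ⟨(continuous_STFT f.continuous f.integrable).measurable, exists_norm_STFT_le f⟩

theorem synthesis_STFT (f : 𝓢(EuclideanSpace ℝ (Fin d), ℂ)) (t : EuclideanSpace ℝ (Fin d)) :
    synthesis (fun z => STFT (fun t => f t) z.1 z.2) t =
      (∫ x : EuclideanSpace ℝ (Fin d), gaussWindow x ^ 2) * f t := by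
  have key (x : EuclideanSpace ℝ (Fin d)) : 𝓕⁻ (fun ξ => STFT (fun t => f t) x ξ) t =
      f t * gaussWindow (t - x) := by
    have hi := (isDecaying_STFT f).integrable_slice x
    simp only [STFT_eq_fourier] at hi ⊢
    have := Continuous.fourierInv_fourier_eq (f := fun t => f t * gaussWindow (t - x))
      (by have := f.continuous; fun_prop) (integrable_mul_gaussWindow f.integrable x) hi
    exact congrFun this t
  simp only [synthesis, key]
  rw [← integral_sub_left_eq_self (fun x => gaussWindow x ^ 2) volume t, ← integral_mul_const]
  refine integral_congr_ae (.of_forall fun x => ?_)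
  simp only
  ring

end Synthesis

section SecondEmbedding

variable {d : ℕ}

theorem integrable_gaussWindow :
    Integrable (gaussWindow : EuclideanSpace ℝ (Fin d) → ℂ) :=
  (integrable_exp_neg_mul_norm_sq pi_pos).ofReal

theorem memLp_two_gaussWindow : MemLp (gaussWindow : EuclideanSpace ℝ (Fin d) → ℂ) 2 :=
  memLp_two_of_bounded integrable_gaussWindow 1 norm_gaussWindow_le_one

theorem integral_gaussWindow_sq_ne_zero :
    ∫ x : EuclideanSpace ℝ (Fin d), gaussWindow x ^ 2 ≠ 0 := by
  have e (x : EuclideanSpace ℝ (Fin d)) :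
      gaussWindow x ^ 2 = ((rexp (-(2 * π) * ‖x‖ ^ 2) : ℝ) : ℂ) := by
    rw [gaussWindow, ← Complex.ofReal_pow, ← Real.exp_nat_mul]
    push_cast
    ring_nf
  simp only [e]
  rw [integral_complex_ofReal, Complex.ofReal_ne_zero]
  exact (integral_exp_pos (integrable_exp_neg_mul_norm_sq (by positivity))).ne'

theorem measure_lt_norm_le {α : Type*} [MeasurableSpace α] {μ : Measure α} {u : α → ℂ}
    (hu : AEMeasurable u μ) {s : ℝ} (hs : 0 < s) :
    μ {y | s < ‖u y‖} ≤ ENNReal.ofReal s⁻¹ * ∫⁻ y, ‖u y‖ₑ ∂μ := by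
  calc μ {y | s < ‖u y‖} ≤ μ {y | ENNReal.ofReal s ≤ ‖u y‖ₑ} := by
        refine measure_mono fun y hy => ?_
        simp only [Set.mem_ofPred_eq] at hy ⊢
        rw [← ofReal_norm]
        exact ENNReal.ofReal_le_ofReal hy.le
    _ ≤ (∫⁻ y, ‖u y‖ₑ ∂μ) / ENNReal.ofReal s :=
        meas_ge_le_lintegral_div hu.enorm (by simpa using hs) ENNReal.ofReal_ne_top
    _ = _ := by rw [ENNReal.ofReal_inv_of_pos hs, ENNReal.div_eq_inv_mul]

theorem IsDecaying.lintegral_synthesis_rpow_le {p : ℝ} (hp1 : 1 < p) (hp2 : p < 2)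
    {F : EuclideanSpace ℝ (Fin d) × EuclideanSpace ℝ (Fin d) → ℂ} (hF : IsDecaying F) :
    ∫⁻ t, ‖synthesis F t‖ₑ ^ p ≤ ENNReal.ofReal p *
      ((∫⁻ t : EuclideanSpace ℝ (Fin d), ‖gaussWindow t‖ₑ) * 2 * ENNReal.ofReal (1 / (p - 1)) +
      (∫⁻ t : EuclideanSpace ℝ (Fin d), ‖gaussWindow t‖ₑ ^ 2) * 4 *
        ENNReal.ofReal (1 / (2 - p))) * ∫⁻ z, ‖F z‖ₑ ^ p := by
  have hl (t : ℝ) : IsDecaying ({z | t < ‖F z‖}.indicator F) :=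
    hF.indicator (measurableSet_lt measurable_const hF.1.norm)
  have hs (t : ℝ) : IsDecaying ({z | ‖F z‖ ≤ t}.indicator F) :=
    hF.indicator (measurableSet_le hF.1.norm measurable_const)
  refine lintegral_enorm_rpow_le_of_split hp1 hp2 hF.1
    (stronglyMeasurable_synthesis hF.1).measurable.aemeasurable _ _
    (fun t => synthesis ({z | t < ‖F z‖}.indicator F))
    (fun t => synthesis ({z | ‖F z‖ ≤ t}.indicator F)) (fun t _ y => ?_)
    (fun t _ => (stronglyMeasurable_synthesis (hs t).1).measurable.aemeasurable)
    (fun t _ s hs0 => ?_) (fun t _ => (hs t).lintegral_enorm_synthesis_sq_le)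
  · rw [← (hl t).synthesis_add (hs t)]
    congr 1
    ext z
    by_cases hz : t < ‖F z‖
    · simp [hz, hz.not_ge]
    · simp [hz, not_lt.1 hz]
  · refine (measure_lt_norm_le (stronglyMeasurable_synthesis (hl t).1).measurable.aemeasurable
      hs0).trans ?_
    rw [mul_comm _ (ENNReal.ofReal s⁻¹), mul_assoc]
    gcongr
    exact lintegral_enorm_synthesis_le (hl t).1

theorem exists_lintegral_rpow_le_STFT (d : ℕ) {p : ℝ} (hp1 : 1 < p) (hp2 : p ≤ 2) :
    ∃ C : ℝ≥0∞, C ≠ ∞ ∧ ∀ f : 𝓢(EuclideanSpace ℝ (Fin d), ℂ),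
      ∫⁻ t, ‖f t‖ₑ ^ p ≤ C * ∫⁻ z : EuclideanSpace ℝ (Fin d) × EuclideanSpace ℝ (Fin d),
        ‖STFT (fun t => f t) z.1 z.2‖ₑ ^ p := by
  have g1 : ∫⁻ t : EuclideanSpace ℝ (Fin d), ‖gaussWindow t‖ₑ ≠ ∞ := integrable_gaussWindow.2.ne
  have g2 : ∫⁻ t : EuclideanSpace ℝ (Fin d), ‖gaussWindow t‖ₑ ^ 2 ≠ ∞ := by
    rw [lintegral_enorm_sq_eq_eLpNorm]
    exact ENNReal.pow_ne_top memLp_two_gaussWindow.2.ne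
  set c : ℂ := ∫ x : EuclideanSpace ℝ (Fin d), gaussWindow x ^ 2 with hc
  have hc0 : ‖c‖ₑ ^ p ≠ 0 := by
    simp [integral_gaussWindow_sq_ne_zero, hc, ENNReal.rpow_eq_zero_iff]
  have hct : ‖c‖ₑ ^ p ≠ ∞ := by
    exact ENNReal.rpow_ne_top_of_nonneg (by linarith) enorm_ne_top
  obtain ⟨K, hK, h⟩ : ∃ K : ℝ≥0∞, K ≠ ∞ ∧
      ∀ F : EuclideanSpace ℝ (Fin d) × EuclideanSpace ℝ (Fin d) → ℂ, IsDecaying F →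
      ∫⁻ t, ‖synthesis F t‖ₑ ^ p ≤ K * ∫⁻ z, ‖F z‖ₑ ^ p := by
    rcases hp2.lt_or_eq with hp2 | rfl
    · exact ⟨_, by finiteness, fun F hF => hF.lintegral_synthesis_rpow_le hp1 hp2⟩
    · exact ⟨_, g2, fun F hF => by
        simpa only [ENNReal.rpow_two] using hF.lintegral_enorm_synthesis_sq_le⟩
  refine ⟨(‖c‖ₑ ^ p)⁻¹ * K, by finiteness, fun f => ?_⟩
  have := h _ (isDecaying_STFT f)
  simp only [synthesis_STFT, enorm_mul, ← hc] at this
  simp only [ENNReal.mul_rpow_of_nonneg _ _ (by linarith : 0 ≤ p)] at this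
  rw [lintegral_const_mul' _ _ hct] at this
  rw [mul_assoc, ← ENNReal.div_eq_inv_mul, ENNReal.le_div_iff_mul_le (.inl hc0) (.inl hct),
    mul_comm]
  exact this

end SecondEmbedding

section BesselSTFT

theorem rpow_mul_exp_neg_le {a X : ℝ} (ha : 0 < a) (hX : 0 < X) :
    X ^ a * rexp (-X) ≤ rexp (a * Real.log a - a) := by
  rw [Real.rpow_def_of_pos hX, ← Real.exp_add]
  gcongr
  have h := Real.log_le_sub_one_of_pos (div_pos hX ha)
  rw [Real.log_div hX.ne' ha.ne'] at h
  have := mul_le_mul_of_nonneg_right h ha.le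
  field_simp at this
  linarith

theorem exp_neg_half_mul_exp_neg_sq_div_le {s : ℝ} (hs : 0 ≤ s) (r : ℝ) :
    rexp (-(s / 2)) * rexp (-π ^ 2 * r ^ 2 / (π + s)) ≤ rexp (π / 2) * rexp (-r) := by
  rw [← Real.exp_add, ← Real.exp_add]
  refine Real.exp_le_exp.2 ?_
  have hb : 0 < π + s := by positivity
  rw [← sub_nonneg]
  have : π / 2 + -r - (-(s / 2) + -π ^ 2 * r ^ 2 / (π + s)) =
      ((π + s) ^ 2 / 2 + π ^ 2 * r ^ 2 - r * (π + s)) / (π + s) := by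
    field_simp
    ring
  rw [this]
  refine div_nonneg ?_ hb.le
  have h9 : 1 ≤ π ^ 2 := by nlinarith [pi_gt_three]
  nlinarith [sq_nonneg (π + s - r), mul_le_mul_of_nonneg_right h9 (sq_nonneg r), sq_nonneg r]

theorem exp_neg_half_mul_exp_neg_sq_le {s : ℝ} (hs : 0 ≤ s) (r : ℝ) :
    rexp (-(s / 2)) * rexp (-(π * s / (π + s)) * r ^ 2) ≤
      rexp (-((1 + r ^ 2) / 2 * s)) + rexp (-(1 / 2 * s)) * rexp (-(π / 2) * r ^ 2) := by
  have hb : 0 < π + s := by positivity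
  rcases le_total s π with h | h
  · refine le_add_of_le_of_nonneg ?_ (by positivity)
    rw [← Real.exp_add]
    gcongr
    have : s / 2 ≤ π * s / (π + s) := by
      rw [div_le_div_iff₀ two_pos hb]; nlinarith [pi_pos]
    nlinarith [mul_le_mul_of_nonneg_right this (sq_nonneg r)]
  · refine le_add_of_nonneg_of_le (by positivity) ?_
    have : π / 2 ≤ π * s / (π + s) := by
      rw [div_le_div_iff₀ two_pos hb]; nlinarith [pi_pos]
    gcongr
    linarith

theorem continuous_one_add_norm_sq_rpow {E : Type*} [NormedAddCommGroup E] (a : ℝ) :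
    Continuous fun η : E => (1 + ‖η‖ ^ 2) ^ a :=
  Continuous.rpow_const (by fun_prop) fun η => .inl (by positivity)

variable {E : Type*} [NormedAddCommGroup E] [InnerProductSpace ℝ E] [FiniteDimensional ℝ E]
  [MeasurableSpace E] [BorelSpace E]

/-- The Gaussian short-time Fourier transform, up to a unimodular factor, of the Bessel potential
`(1 - Δ/4π²)^{-k/2} h`. -/
def besselSTFT (k : ℝ) (h : E → ℂ) (x ξ : E) : ℂ :=
  ∫ η, 𝓕 h η * (((1 + ‖η‖ ^ 2) ^ (-(k / 2)) : ℝ) : ℂ) * heatAtom 0 x ξ η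

theorem Gamma_mul_besselSTFT_eq {k : ℝ} (hk : 0 < k) {h : E → ℂ} (hh : Integrable h) (x ξ : E) :
    (Real.Gamma (k / 2) : ℂ) * besselSTFT k h x ξ =
      ∫ s in Set.Ioi (0 : ℝ), ((s ^ (k / 2 - 1) * rexp (-s) : ℝ) : ℂ) *
        ∫ y, h y * 𝓕 (heatAtom s x ξ) y := by
  have hk2 : 0 < k / 2 := by positivity
  have hF := continuous_fourier_of_integrable hh
  have hprod : Integrable (fun z : E × ℝ => ((z.2 ^ (k / 2 - 1) * rexp (-z.2) : ℝ) : ℂ) *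
      (𝓕 h z.1 * heatAtom z.2 x ξ z.1)) (volume.prod (volume.restrict (Set.Ioi 0))) := by
    have hg : IntegrableOn (fun s : ℝ => s ^ (k / 2 - 1) * rexp (-s)) (Set.Ioi 0) := by
      simpa only [mul_comm] using Real.GammaIntegral_convergent hk2
    refine Integrable.mono' (((integrable_exp_neg_pi_mul_norm_sub_sq ξ).const_mul
      (∫ y, ‖h y‖)).mul_prod hg) ?_ ?_
    · refine Measurable.aestronglyMeasurable ?_
      have : Measurable fun z : E × ℝ => heatAtom z.2 x ξ z.1 :=
        Continuous.measurable (by fun_prop)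
      have := hF.measurable
      fun_prop
    · have : ∀ᵐ z : E × ℝ ∂volume.prod (volume.restrict (Set.Ioi 0)), z.2 ∈ Set.Ioi (0 : ℝ) :=
        Measure.quasiMeasurePreserving_snd.ae (ae_restrict_mem measurableSet_Ioi)
      filter_upwards [this] with z hz
      have hz0 : (0 : ℝ) < z.2 := hz
      rw [norm_mul, norm_mul, Complex.norm_real, Real.norm_of_nonneg (by positivity), mul_comm]
      gcongr
      · exact norm_fourier_le_integral_norm _ _
      · exact norm_heatAtom_le hz0.le _ _ _
  calc (Real.Gamma (k / 2) : ℂ) * besselSTFT k h x ξ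
      = ∫ η, ∫ s in Set.Ioi (0 : ℝ), ((s ^ (k / 2 - 1) * rexp (-s) : ℝ) : ℂ) *
          (𝓕 h η * heatAtom s x ξ η) := by
        rw [besselSTFT, ← integral_const_mul]
        refine integral_congr_ae (.of_forall fun η => ?_)
        have hr : 0 < 1 + ‖η‖ ^ 2 := by positivity
        have hG := Real.integral_rpow_mul_exp_neg_mul_Ioi hk2 hr
        have e (s : ℝ) : ((s ^ (k / 2 - 1) * rexp (-s) : ℝ) : ℂ) * (𝓕 h η * heatAtom s x ξ η) =
            ((s ^ (k / 2 - 1) * rexp (-((1 + ‖η‖ ^ 2) * s)) : ℝ) : ℂ) *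
              (𝓕 h η * heatAtom 0 x ξ η) := by
          rw [heatAtom_eq, show -((1 + ‖η‖ ^ 2) * s) = -s + -s * ‖η‖ ^ 2 by ring, Real.exp_add]
          push_cast
          ring
        simp only [e]
        rw [integral_mul_const, integral_complex_ofReal, hG, one_div,
          Real.inv_rpow hr.le, Real.rpow_neg hr.le]
        push_cast
        ring
    _ = ∫ s in Set.Ioi (0 : ℝ), ∫ η, ((s ^ (k / 2 - 1) * rexp (-s) : ℝ) : ℂ) *
          (𝓕 h η * heatAtom s x ξ η) := integral_integral_swap hprod
    _ = _ := by
        refine setIntegral_congr_fun measurableSet_Ioi fun s hs => ?_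
        rw [integral_const_mul, integral_fourier_mul_eq_of_integrable hh
          (integrable_heatAtom (le_of_lt hs) x ξ)]

theorem integrable_norm_mul_exp_neg {h : E → ℂ} (hh : Integrable h) (x : E) :
    Integrable fun y => ‖h y‖ * rexp (-‖x - y‖) := by
  refine hh.norm.mul_bdd (c := 1) (by fun_prop) (.of_forall fun y => ?_)
  rw [Real.norm_of_nonneg (by positivity), Real.exp_le_one_iff]
  simp

theorem norm_integral_mul_fourier_heatAtom_le {h : E → ℂ} (hh : Integrable h) {s : ℝ}
    (hs : 0 ≤ s) (x ξ : E) : rexp (-s) * ‖∫ y, h y * 𝓕 (heatAtom s x ξ) y‖ ≤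
      rexp (π / 2) * (∫ y, ‖h y‖ * rexp (-‖x - y‖)) *
        (rexp (-((1 + ‖ξ‖ ^ 2) / 2 * s)) + rexp (-(1 / 2 * s)) * rexp (-(π / 2) * ‖ξ‖ ^ 2)) := by
  set K := rexp (-((1 + ‖ξ‖ ^ 2) / 2 * s)) + rexp (-(1 / 2 * s)) * rexp (-(π / 2) * ‖ξ‖ ^ 2)
  calc rexp (-s) * ‖∫ y, h y * 𝓕 (heatAtom s x ξ) y‖
      ≤ rexp (-s) * ∫ y, ‖h y * 𝓕 (heatAtom s x ξ) y‖ := by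
        gcongr; exact norm_integral_le_integral_norm _
    _ = ∫ y, rexp (-s) * ‖h y * 𝓕 (heatAtom s x ξ) y‖ := by rw [integral_const_mul]
    _ ≤ ∫ y, (‖h y‖ * rexp (-‖x - y‖)) * (rexp (π / 2) * K) := by
        refine integral_mono_of_nonneg (.of_forall fun y => by positivity)
          ((integrable_norm_mul_exp_neg hh x).mul_const _) (.of_forall fun y => ?_)
        simp only [norm_mul]
        calc rexp (-s) * (‖h y‖ * ‖𝓕 (heatAtom s x ξ) y‖)
            ≤ rexp (-s) * (‖h y‖ * (rexp (-(π * s / (π + s)) * ‖ξ‖ ^ 2) *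
                rexp (-π ^ 2 * ‖x - y‖ ^ 2 / (π + s)))) := by
              gcongr; exact norm_fourier_heatAtom_le hs x ξ y
          _ = ‖h y‖ * ((rexp (-(s / 2)) * rexp (-π ^ 2 * ‖x - y‖ ^ 2 / (π + s))) *
                (rexp (-(s / 2)) * rexp (-(π * s / (π + s)) * ‖ξ‖ ^ 2))) := by
              rw [show -s = -(s / 2) + -(s / 2) by ring, Real.exp_add]; ring
          _ ≤ ‖h y‖ * ((rexp (π / 2) * rexp (-‖x - y‖)) * K) := by
              gcongr ‖h y‖ * (?_ * ?_)
              · exact exp_neg_half_mul_exp_neg_sq_div_le hs _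
              · exact exp_neg_half_mul_exp_neg_sq_le hs _
          _ = _ := by ring
    _ = _ := by rw [integral_mul_const]; ring

theorem exists_norm_besselSTFT_le (E : Type*) [NormedAddCommGroup E] [InnerProductSpace ℝ E]
    [FiniteDimensional ℝ E] [MeasurableSpace E] [BorelSpace E] {k : ℝ} (hk : 0 < k) :
    ∃ C : ℝ, 0 < C ∧ ∀ h : E → ℂ, Integrable h → ∀ x ξ : E,
      ‖besselSTFT k h x ξ‖ ≤
        C * (1 + ‖ξ‖ ^ 2) ^ (-(k / 2)) * ∫ y, ‖h y‖ * rexp (-‖x - y‖) := by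
  have hk2 : 0 < k / 2 := by positivity
  have hΓ := Real.Gamma_pos_of_pos hk2
  set M := rexp (k / 2 * Real.log (k / 2) - k / 2) with hM
  refine ⟨rexp (π / 2) * (2 ^ (k / 2) * (1 + M * rexp 1)), by positivity, fun h hh x ξ => ?_⟩
  set H := ∫ y, ‖h y‖ * rexp (-‖x - y‖) with hH
  have hH0 : 0 ≤ H := integral_nonneg fun y => by positivity
  have hr : 0 < (1 + ‖ξ‖ ^ 2) / 2 := by positivity
  have i1 := Real.integral_rpow_mul_exp_neg_mul_Ioi hk2 hr
  have i2 := Real.integral_rpow_mul_exp_neg_mul_Ioi hk2 (one_half_pos (α := ℝ))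
  have j1 : IntegrableOn (fun s : ℝ => s ^ (k / 2 - 1) * rexp (-((1 + ‖ξ‖ ^ 2) / 2 * s)))
      (Set.Ioi 0) := by
    refine Integrable.of_integral_ne_zero (i1.trans_ne ?_)
    positivity
  have j2 : IntegrableOn (fun s : ℝ => s ^ (k / 2 - 1) * rexp (-(1 / 2 * s)))
      (Set.Ioi 0) := by
    refine Integrable.of_integral_ne_zero (i2.trans_ne ?_)
    positivity
  have hexp : rexp (-(π / 2) * ‖ξ‖ ^ 2) ≤ M * rexp 1 * (1 + ‖ξ‖ ^ 2) ^ (-(k / 2)) := by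
    have hX : 0 < 1 + ‖ξ‖ ^ 2 := by positivity
    have := rpow_mul_exp_neg_le hk2 hX
    rw [Real.rpow_neg hX.le, ← div_eq_mul_inv, le_div_iff₀ (by positivity)]
    calc rexp (-(π / 2) * ‖ξ‖ ^ 2) * (1 + ‖ξ‖ ^ 2) ^ (k / 2)
        ≤ rexp (1 + -(1 + ‖ξ‖ ^ 2)) * (1 + ‖ξ‖ ^ 2) ^ (k / 2) := by
          gcongr
          nlinarith [pi_gt_three, sq_nonneg ‖ξ‖]
      _ = ((1 + ‖ξ‖ ^ 2) ^ (k / 2) * rexp (-(1 + ‖ξ‖ ^ 2))) * rexp 1 := by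
          rw [Real.exp_add]; ring
      _ ≤ _ := by gcongr
  have key : Real.Gamma (k / 2) * ‖besselSTFT k h x ξ‖ ≤
      rexp (π / 2) * H * ((1 / ((1 + ‖ξ‖ ^ 2) / 2)) ^ (k / 2) * Real.Gamma (k / 2) +
        (1 / (1 / 2)) ^ (k / 2) * Real.Gamma (k / 2) * rexp (-(π / 2) * ‖ξ‖ ^ 2)) := by
    rw [← i1, ← i2, ← integral_mul_const, ← integral_add j1 (j2.mul_const _),
      ← integral_const_mul]
    have e : Real.Gamma (k / 2) * ‖besselSTFT k h x ξ‖ =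
        ‖(Real.Gamma (k / 2) : ℂ) * besselSTFT k h x ξ‖ := by
      rw [norm_mul, Complex.norm_real, Real.norm_of_nonneg hΓ.le]
    rw [e, Gamma_mul_besselSTFT_eq hk hh]
    refine (norm_integral_le_integral_norm _).trans ?_
    refine integral_mono_of_nonneg (.of_forall fun s => norm_nonneg _)
      ((j1.add (j2.mul_const _)).const_mul _) ?_
    filter_upwards [ae_restrict_mem measurableSet_Ioi] with s hs
    have hs0 : (0 : ℝ) < s := hs
    have := norm_integral_mul_fourier_heatAtom_le hh hs0.le x ξ
    rw [norm_mul, Complex.norm_real, Real.norm_of_nonneg (by positivity), mul_assoc]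
    refine (mul_le_mul_of_nonneg_left this (by positivity)).trans_eq ?_
    rw [← hH]
    ring
  have hX : 0 < 1 + ‖ξ‖ ^ 2 := by positivity
  rw [one_div_div, Real.div_rpow two_pos.le hX.le, one_div_one_div] at key
  refine le_of_mul_le_mul_left (key.trans ?_) hΓ
  calc rexp (π / 2) * H * (2 ^ (k / 2) / (1 + ‖ξ‖ ^ 2) ^ (k / 2) * Real.Gamma (k / 2) +
        2 ^ (k / 2) * Real.Gamma (k / 2) * rexp (-(π / 2) * ‖ξ‖ ^ 2))
      ≤ rexp (π / 2) * H * (2 ^ (k / 2) / (1 + ‖ξ‖ ^ 2) ^ (k / 2) * Real.Gamma (k / 2) +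
        2 ^ (k / 2) * Real.Gamma (k / 2) * (M * rexp 1 * (1 + ‖ξ‖ ^ 2) ^ (-(k / 2)))) := by
        gcongr
    _ = _ := by rw [Real.rpow_neg hX.le]; ring

end BesselSTFT

section BesselSTFTBounds

theorem exp_neg_le_mul_decayWeight {E : Type*} [NormedAddCommGroup E] [InnerProductSpace ℝ E]
    (v : E) : rexp (-‖v‖) ≤
      (Module.finrank ℝ E + 1).factorial * rexp 1 * decayWeight v := by
  have h := Real.pow_div_factorial_le_exp (1 + ‖v‖) (by positivity) (Module.finrank ℝ E + 1)
  rw [div_le_iff₀' (by positivity), Real.exp_add] at h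
  rw [decayWeight, ← div_eq_mul_inv, le_div_iff₀ (by positivity), Real.exp_neg]
  rw [inv_mul_le_iff₀ (Real.exp_pos _)]
  linarith

theorem one_add_norm_sq_le_mul {E : Type*} [NormedAddCommGroup E] (ξ η : E) :
    1 + ‖ξ‖ ^ 2 ≤ 2 * (1 + ‖η - ξ‖) ^ 2 * (1 + ‖η‖ ^ 2) := by
  have h : ‖ξ‖ ≤ ‖η‖ + ‖η - ξ‖ := by
    have := norm_sub_le η (η - ξ)
    simpa using this
  have h2 : ‖ξ‖ ^ 2 ≤ (‖η‖ + ‖η - ξ‖) ^ 2 := by gcongr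
  nlinarith [sq_nonneg (‖η‖ - ‖η - ξ‖), norm_nonneg η, norm_nonneg (η - ξ),
    mul_nonneg (sq_nonneg ‖η‖) (norm_nonneg (η - ξ)),
    mul_nonneg (sq_nonneg ‖η‖) (sq_nonneg ‖η - ξ‖)]

theorem one_add_norm_sq_rpow_neg_le_one {E : Type*} [NormedAddCommGroup E]
    {k : ℝ} (hk : 0 ≤ k) (η : E) :
    (1 + ‖η‖ ^ 2) ^ (-(k / 2)) ≤ 1 :=
  Real.rpow_le_one_of_one_le_of_nonpos (by nlinarith [sq_nonneg ‖η‖]) (by linarith)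

variable {E : Type*} [NormedAddCommGroup E] [InnerProductSpace ℝ E] [FiniteDimensional ℝ E]
  [MeasurableSpace E] [BorelSpace E]

theorem integrable_exp_neg_norm : Integrable fun v : E => rexp (-‖v‖) := by
  refine (integrable_decayWeight.const_mul
    ((Module.finrank ℝ E + 1).factorial * rexp 1)).mono' (by fun_prop) (.of_forall fun v => ?_)
  rw [Real.norm_of_nonneg (by positivity)]
  exact exp_neg_le_mul_decayWeight v

/-- The function whose inverse Fourier transform is `fun x => besselSTFT k h x ξ`. -/
def besselSymbol (k : ℝ) (h : E → ℂ) (ξ η : E) : ℂ :=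
  𝓕 h η * (((1 + ‖η‖ ^ 2) ^ (-(k / 2)) * rexp (-π * ‖η - ξ‖ ^ 2) : ℝ) : ℂ)

theorem besselSTFT_eq_fourierInv (k : ℝ) (h : E → ℂ) (x ξ : E) :
    besselSTFT k h x ξ = 𝓕⁻ (besselSymbol k h ξ) x := by
  rw [besselSTFT, Real.fourierInv_eq']
  refine integral_congr_ae (.of_forall fun η => ?_)
  simp only [besselSymbol, heatAtom, smul_eq_mul, real_inner_comm η x]
  rw [Complex.exp_add, ← Complex.ofReal_exp]
  push_cast
  ring_nf

theorem continuous_besselSymbol (k : ℝ) {h : E → ℂ} (hh : Integrable h) :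
    Continuous fun z : E × E => besselSymbol k h z.1 z.2 := by
  have := continuous_fourier_of_integrable hh
  have := (continuous_one_add_norm_sq_rpow (E := E) (-(k / 2))).comp (continuous_snd (X := E))
  simp only [Function.comp_def] at this
  unfold besselSymbol
  exact Continuous.mul (by fun_prop) (Complex.continuous_ofReal.comp (this.mul (by fun_prop)))

theorem norm_besselSymbol_le {k : ℝ} (hk : 0 ≤ k) (h : E → ℂ) (ξ η : E) :
    ‖besselSymbol k h ξ η‖ ≤ (∫ y, ‖h y‖) * rexp (-π * ‖η - ξ‖ ^ 2) := by
  rw [besselSymbol, norm_mul, Complex.norm_real, Real.norm_of_nonneg (by positivity)]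
  gcongr
  · exact norm_fourier_le_integral_norm _ _
  · exact mul_le_of_le_one_left (by positivity) (one_add_norm_sq_rpow_neg_le_one hk η)

theorem integrable_besselSymbol {k : ℝ} (hk : 0 ≤ k) {h : E → ℂ} (hh : Integrable h) (ξ : E) :
    Integrable (besselSymbol k h ξ) :=
  ((integrable_exp_neg_pi_mul_norm_sub_sq ξ).const_mul _).mono'
    ((continuous_besselSymbol k hh).comp (by fun_prop : Continuous fun η => (ξ, η))
      ).aestronglyMeasurable (.of_forall fun η => norm_besselSymbol_le hk h ξ η)

theorem memLp_two_besselSymbol {k : ℝ} (hk : 0 ≤ k) {h : E → ℂ} (hh : Integrable h) (ξ : E) :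
    MemLp (besselSymbol k h ξ) 2 := by
  refine memLp_two_of_bounded (integrable_besselSymbol hk hh ξ) (∫ y, ‖h y‖) fun η => ?_
  refine (norm_besselSymbol_le hk h ξ η).trans (mul_le_of_le_one_right (by positivity) ?_)
  rw [Real.exp_le_one_iff]
  nlinarith [pi_pos, mul_nonneg pi_pos.le (sq_nonneg ‖η - ξ‖)]

theorem besselSTFT_add {k : ℝ} (hk : 0 ≤ k) {h₁ h₂ : E → ℂ} (hh₁ : Integrable h₁)
    (hh₂ : Integrable h₂) (x ξ : E) :
    besselSTFT k (h₁ + h₂) x ξ = besselSTFT k h₁ x ξ + besselSTFT k h₂ x ξ := by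
  simp only [besselSTFT_eq_fourierInv]
  rw [← fourierInv_add_of_integrable (integrable_besselSymbol hk hh₁ ξ)
    (integrable_besselSymbol hk hh₂ ξ)]
  refine congrArg (fun u : E → ℂ => 𝓕⁻ u x) (funext fun η => ?_)
  have : 𝓕 (h₁ + h₂) η = 𝓕 h₁ η + 𝓕 h₂ η :=
    congrFun (VectorFourier.fourierIntegral_add continuous_fourierChar (L := innerₗ E)
      continuous_inner hh₁ hh₂) η
  simp only [besselSymbol, this, add_mul]

theorem measurable_besselSTFT (k : ℝ) {h : E → ℂ} (hh : Integrable h) :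
    Measurable fun z : E × E => besselSTFT k h z.1 z.2 := by
  have hc : Measurable fun q : (E × E) × E =>
      𝓕 h q.2 * (((1 + ‖q.2‖ ^ 2) ^ (-(k / 2)) : ℝ) : ℂ) * heatAtom 0 q.1.1 q.1.2 q.2 := by
    have := (continuous_one_add_norm_sq_rpow (E := E) (-(k / 2))).measurable
    have := (continuous_fourier_of_integrable hh).measurable
    have : Measurable fun q : (E × E) × E => heatAtom 0 q.1.1 q.1.2 q.2 :=
      Continuous.measurable (by fun_prop)
    fun_prop
  exact hc.stronglyMeasurable.integral_prod_right'.measurable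

theorem lintegral_besselSTFT_sq_le {k : ℝ} (hk : 0 ≤ k) {h : E → ℂ} (h1 : Integrable h)
    (h2 : MemLp h 2) :
    ∫⁻ z : E × E, ENNReal.ofReal ((1 + ‖z.2‖ ^ 2) ^ k) * ‖besselSTFT k h z.1 z.2‖ₑ ^ 2 ≤
      (∫⁻ v : E, ENNReal.ofReal (2 ^ k * ((1 + ‖v‖) ^ (2 * k) * rexp (-π * ‖v‖ ^ 2)))) *
        ∫⁻ y, ‖h y‖ₑ ^ 2 := by
  have mw := (continuous_one_add_norm_sq_rpow (E := E) k).measurable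
  have ms := (continuous_besselSymbol k h1).measurable
  have mb := measurable_besselSTFT k h1
  have mF := (continuous_fourier_of_integrable h1).measurable
  have mg : Measurable fun v : E => (1 + ‖v‖) ^ (2 * k) := by fun_prop
  calc ∫⁻ z : E × E, ENNReal.ofReal ((1 + ‖z.2‖ ^ 2) ^ k) * ‖besselSTFT k h z.1 z.2‖ₑ ^ 2
      = ∫⁻ ξ : E, ∫⁻ x : E, ENNReal.ofReal ((1 + ‖ξ‖ ^ 2) ^ k) * ‖besselSTFT k h x ξ‖ₑ ^ 2 := by
        rw [Measure.volume_eq_prod, lintegral_prod_symm _ (Measurable.aemeasurable (by fun_prop))]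
    _ = ∫⁻ ξ : E, ∫⁻ η : E, ENNReal.ofReal ((1 + ‖ξ‖ ^ 2) ^ k) * ‖besselSymbol k h ξ η‖ₑ ^ 2 := by
        refine lintegral_congr fun ξ => ?_
        rw [lintegral_const_mul' _ _ ENNReal.ofReal_ne_top,
          lintegral_const_mul' _ _ ENNReal.ofReal_ne_top,
          ← lintegral_fourierInv_sq_eq (integrable_besselSymbol hk h1 ξ)
            (memLp_two_besselSymbol hk h1 ξ)]
        simp only [besselSTFT_eq_fourierInv]
    _ = ∫⁻ η : E, ∫⁻ ξ : E, ENNReal.ofReal ((1 + ‖ξ‖ ^ 2) ^ k) * ‖besselSymbol k h ξ η‖ₑ ^ 2 :=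
        lintegral_lintegral_swap (Measurable.aemeasurable (by fun_prop))
    _ ≤ ∫⁻ η : E, ∫⁻ ξ : E, ‖𝓕 h η‖ₑ ^ 2 *
          ENNReal.ofReal (2 ^ k * ((1 + ‖η - ξ‖) ^ (2 * k) * rexp (-π * ‖η - ξ‖ ^ 2))) := by
        refine lintegral_mono fun η => lintegral_mono fun ξ => ?_
        rw [besselSymbol, enorm_mul, mul_pow, mul_left_comm]
        gcongr
        rw [← ofReal_norm, Complex.norm_real, Real.norm_of_nonneg (by positivity),
          ← ENNReal.ofReal_pow (by positivity), ← ENNReal.ofReal_mul (by positivity)]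
        refine ENNReal.ofReal_le_ofReal ?_
        have hX : 0 < 1 + ‖η‖ ^ 2 := by positivity
        have e1 : ((1 + ‖η‖ ^ 2) ^ (-(k / 2))) ^ 2 = ((1 + ‖η‖ ^ 2) ^ k)⁻¹ := by
          rw [← Real.rpow_natCast, ← Real.rpow_mul hX.le, ← Real.rpow_neg hX.le]
          congr 1
          push_cast
          ring
        have e2 : rexp (-π * ‖η - ξ‖ ^ 2) ^ 2 ≤ rexp (-π * ‖η - ξ‖ ^ 2) := by
          refine pow_le_of_le_one (by positivity) ?_ two_ne_zero
          rw [Real.exp_le_one_iff]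
          nlinarith [pi_pos, mul_nonneg pi_pos.le (sq_nonneg ‖η - ξ‖)]
        have e3 : (1 + ‖ξ‖ ^ 2) ^ k ≤ 2 ^ k * (1 + ‖η - ξ‖) ^ (2 * k) * (1 + ‖η‖ ^ 2) ^ k := by
          refine (Real.rpow_le_rpow (by positivity) (one_add_norm_sq_le_mul ξ η) hk).trans_eq ?_
          rw [Real.mul_rpow (by positivity) (by positivity),
            Real.mul_rpow (by positivity) (by positivity), ← Real.rpow_natCast,
            ← Real.rpow_mul (by positivity)]
          norm_num
        rw [mul_pow, e1]
        calc (1 + ‖ξ‖ ^ 2) ^ k * (((1 + ‖η‖ ^ 2) ^ k)⁻¹ * rexp (-π * ‖η - ξ‖ ^ 2) ^ 2)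
            ≤ (2 ^ k * (1 + ‖η - ξ‖) ^ (2 * k) * (1 + ‖η‖ ^ 2) ^ k) *
              (((1 + ‖η‖ ^ 2) ^ k)⁻¹ * rexp (-π * ‖η - ξ‖ ^ 2)) := by gcongr
          _ = _ := by field_simp
    _ = ∫⁻ η : E, ‖𝓕 h η‖ₑ ^ 2 *
          ∫⁻ v : E, ENNReal.ofReal (2 ^ k * ((1 + ‖v‖) ^ (2 * k) * rexp (-π * ‖v‖ ^ 2))) := by
        refine lintegral_congr fun η => ?_
        rw [lintegral_const_mul _ (by fun_prop), lintegral_sub_left_eq_self (fun v =>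
          ENNReal.ofReal (2 ^ k * ((1 + ‖v‖) ^ (2 * k) * rexp (-π * ‖v‖ ^ 2)))) η]
    _ = _ := by
        rw [lintegral_mul_const _ (by fun_prop), lintegral_fourier_sq_eq h1 h2, mul_comm]

theorem lintegral_rpow_mul_exp_ne_top {k : ℝ} :
    ∫⁻ v : E, ENNReal.ofReal (2 ^ k * ((1 + ‖v‖) ^ (2 * k) * rexp (-π * ‖v‖ ^ 2))) ≠ ∞ := by
  refine ne_top_of_le_ne_top (((integrable_one_add_pow_mul_exp (E := E) ⌈2 * k⌉₊).const_mul
    (2 ^ k)).lintegral_lt_top.ne) ?_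
  gcongr with v
  rw [← Real.rpow_natCast]
  gcongr
  · linarith [norm_nonneg v]
  · exact Nat.le_ceil _

end BesselSTFTBounds

section FirstEmbedding

variable {E : Type*} [NormedAddCommGroup E] [InnerProductSpace ℝ E] [FiniteDimensional ℝ E]
  [MeasurableSpace E] [BorelSpace E]

/-- The frequency weight `⟨ξ⟩^{-2n}` on `E`, where `n` is the dimension of `E`. -/
def freqWeight (ξ : E) : ℝ≥0∞ := ENNReal.ofReal ((1 + ‖ξ‖ ^ 2) ^ Module.finrank ℝ E)⁻¹

theorem measurable_freqWeight {E : Type*} [NormedAddCommGroup E] [InnerProductSpace ℝ E]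
    [MeasurableSpace E] [BorelSpace E] : Measurable (freqWeight : E → ℝ≥0∞) := by
  unfold freqWeight
  fun_prop

theorem lintegral_freqWeight_ne_top [Nontrivial E] : ∫⁻ ξ : E, freqWeight ξ ≠ ∞ := by
  have hn : 0 < Module.finrank ℝ E := Module.finrank_pos
  have := integrable_rpow_neg_one_add_norm_sq (E := E) (μ := volume)
    (r := 2 * Module.finrank ℝ E) (by norm_cast; omega)
  refine ne_of_eq_of_ne (lintegral_congr fun ξ => ?_) this.lintegral_lt_top.ne
  rw [freqWeight, show -(2 * (Module.finrank ℝ E : ℝ)) / 2 = -(Module.finrank ℝ E : ℝ) by ring,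
    Real.rpow_neg (by positivity), Real.rpow_natCast]

theorem setLIntegral_freqWeight_le {r : ℝ} (hr : 0 < r) :
    ∫⁻ ξ in {ξ : E | r ^ 2 < 1 + ‖ξ‖ ^ 2}, freqWeight ξ ≤
      ENNReal.ofReal (2 ^ Module.finrank ℝ E * (r ^ Module.finrank ℝ E)⁻¹) *
        ∫⁻ ξ : E, freqWeight ξ := by
  set n := Module.finrank ℝ E with hn
  set S := {ξ : E | r ^ 2 < 1 + ‖ξ‖ ^ 2} with hS
  have hSm : MeasurableSet S := measurableSet_lt measurable_const (by fun_prop)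
  have hφ : Measurable (S.indicator freqWeight) := measurable_freqWeight.indicator hSm
  have hscale : ∫⁻ ξ, S.indicator freqWeight ξ =
      ENNReal.ofReal (r ^ n) * ∫⁻ η : E, S.indicator freqWeight (r • η) := by
    have h := Measure.map_addHaar_smul (volume : Measure E) hr.ne'
    rw [← lintegral_map hφ (measurable_const_smul r), h, lintegral_smul_measure, smul_eq_mul,
      ← mul_assoc, ← ENNReal.ofReal_mul (by positivity), abs_of_pos (by positivity),
      mul_inv_cancel₀ (by positivity), ENNReal.ofReal_one, one_mul]
  have hpt (η : E) : S.indicator freqWeight (r • η) ≤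
      ENNReal.ofReal (2 ^ n * ((r ^ 2) ^ n)⁻¹) * freqWeight η := by
    by_cases hη : r • η ∈ S
    · rw [Set.indicator_of_mem hη, freqWeight, freqWeight, ← ENNReal.ofReal_mul (by positivity)]
      refine ENNReal.ofReal_le_ofReal ?_
      simp only [hS, Set.mem_ofPred_eq, norm_smul, Real.norm_of_nonneg hr.le, mul_pow] at hη ⊢
      have hbase : (1 + r ^ 2 * ‖η‖ ^ 2)⁻¹ ≤ 2 * (r ^ 2)⁻¹ * (1 + ‖η‖ ^ 2)⁻¹ := by
        rw [← div_eq_mul_inv, ← div_eq_mul_inv, div_div, inv_eq_one_div,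
          div_le_div_iff₀ (by positivity) (by positivity)]
        nlinarith
      simpa only [mul_pow, inv_pow] using pow_le_pow_left₀ (by positivity) hbase n
    · simp [hη]
  rw [← lintegral_indicator hSm, hscale]
  calc ENNReal.ofReal (r ^ n) * ∫⁻ η : E, S.indicator freqWeight (r • η)
      ≤ ENNReal.ofReal (r ^ n) *
          ∫⁻ η : E, ENNReal.ofReal (2 ^ n * ((r ^ 2) ^ n)⁻¹) * freqWeight η := by
        gcongr with η
        exact hpt η
    _ = _ := by
        rw [lintegral_const_mul _ measurable_freqWeight, ← mul_assoc,
          ← ENNReal.ofReal_mul (by positivity)]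
        congr 2
        rw [← pow_mul, mul_comm 2 n, pow_mul]
        field_simp

theorem setLIntegral_freqWeight_rpow_le [Nontrivial E] {s M : ℝ} (hs : 0 < s) (hM : 0 ≤ M) :
    ∫⁻ ξ in {ξ : E | s < M * (1 + ‖ξ‖ ^ 2) ^ ((Module.finrank ℝ E : ℝ) / 2)}, freqWeight ξ ≤
      ENNReal.ofReal (2 ^ Module.finrank ℝ E * (s⁻¹ * M)) * ∫⁻ ξ : E, freqWeight ξ := by
  rcases hM.eq_or_lt with rfl | hM
  · simp [hs.not_gt]
  have hn : (Module.finrank ℝ E : ℝ) ≠ 0 := by exact_mod_cast (Module.finrank_pos (R := ℝ)).ne'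
  set r : ℝ := (s / M) ^ (1 / (Module.finrank ℝ E : ℝ)) with hr
  have hr0 : 0 < r := by positivity
  have hrn : r ^ Module.finrank ℝ E = s / M := by
    rw [hr, ← Real.rpow_natCast, ← Real.rpow_mul (by positivity), one_div_mul_cancel hn,
      Real.rpow_one]
  have h := setLIntegral_freqWeight_le (E := E) hr0
  rw [hrn, inv_div, div_eq_inv_mul] at h
  refine (lintegral_mono_set fun ξ hξ => ?_).trans h
  simp only [Set.mem_ofPred_eq] at hξ ⊢
  by_contra! hcon
  have h1 : (1 + ‖ξ‖ ^ 2) ^ ((Module.finrank ℝ E : ℝ) / 2) ≤ s / M := by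
    calc (1 + ‖ξ‖ ^ 2) ^ ((Module.finrank ℝ E : ℝ) / 2)
        ≤ (r ^ 2) ^ ((Module.finrank ℝ E : ℝ) / 2) := by gcongr
      _ = s / M := by
        rw [← hrn, ← Real.rpow_natCast, ← Real.rpow_natCast, ← Real.rpow_mul hr0.le]
        congr 1
        push_cast
        ring
  rw [le_div_iff₀ hM] at h1
  linarith

/-- Lebesgue measure on phase space, weighted by `freqWeight` in the frequency variable. -/
def phaseMeasure (E : Type*) [NormedAddCommGroup E] [InnerProductSpace ℝ E]
    [FiniteDimensional ℝ E] [MeasurableSpace E] [BorelSpace E] : Measure (E × E) :=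
  volume.withDensity fun z => freqWeight z.2

/-- The function `besselSTFT k h`, renormalised for interpolation with respect to
`phaseMeasure`. -/
def weightedBesselSTFT (k : ℝ) (h : E → ℂ) (z : E × E) : ℂ :=
  (((1 + ‖z.2‖ ^ 2) ^ ((Module.finrank ℝ E + k) / 2) : ℝ) : ℂ) * besselSTFT k h z.1 z.2

theorem measurable_weightedBesselSTFT (k : ℝ) {h : E → ℂ} (hh : Integrable h) :
    Measurable (weightedBesselSTFT k h) := by
  have := measurable_besselSTFT k hh
  unfold weightedBesselSTFT
  fun_prop

theorem enorm_weightedBesselSTFT (k : ℝ) (h : E → ℂ) (z : E × E) :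
    ‖weightedBesselSTFT k h z‖ₑ =
      ENNReal.ofReal ((1 + ‖z.2‖ ^ 2) ^ ((Module.finrank ℝ E + k) / 2)) *
        ‖besselSTFT k h z.1 z.2‖ₑ := by
  rw [weightedBesselSTFT, enorm_mul, ← ofReal_norm (Complex.ofReal _), Complex.norm_real,
    Real.norm_of_nonneg (by positivity)]

theorem lintegral_phaseMeasure_rpow (k : ℝ) {h : E → ℂ} (hh : Integrable h) {p : ℝ}
    (hp : 0 ≤ p) : ∫⁻ z, ‖weightedBesselSTFT k h z‖ₑ ^ p ∂phaseMeasure E =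
      ∫⁻ z : E × E, ENNReal.ofReal ((1 + ‖z.2‖ ^ 2) ^
        (p * ((Module.finrank ℝ E + k) / 2) - Module.finrank ℝ E)) *
        ‖besselSTFT k h z.1 z.2‖ₑ ^ p := by
  have hw : Measurable fun z : E × E => freqWeight z.2 :=
    measurable_freqWeight.comp measurable_snd
  rw [phaseMeasure, lintegral_withDensity_eq_lintegral_mul _ hw
    ((measurable_weightedBesselSTFT k hh).enorm.pow_const p)]
  refine lintegral_congr fun z => ?_
  have hX : 0 < 1 + ‖z.2‖ ^ 2 := by positivity
  simp only [Pi.mul_apply]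
  rw [enorm_weightedBesselSTFT, ENNReal.mul_rpow_of_nonneg _ _ hp, ← mul_assoc, freqWeight,
    ENNReal.ofReal_rpow_of_nonneg (by positivity) hp, ← ENNReal.ofReal_mul (by positivity)]
  congr 2
  rw [← Real.rpow_natCast, ← Real.rpow_neg hX.le, ← Real.rpow_mul hX.le, ← Real.rpow_add hX]
  congr 1
  ring

theorem exists_phaseMeasure_weightedBesselSTFT_le (E : Type*) [NormedAddCommGroup E]
    [InnerProductSpace ℝ E] [FiniteDimensional ℝ E] [MeasurableSpace E] [BorelSpace E]
    [Nontrivial E] {k : ℝ} (hk : 0 < k) :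
    ∃ A : ℝ≥0∞, A ≠ ∞ ∧ ∀ h : E → ℂ, Integrable h → ∀ s : ℝ, 0 < s →
      phaseMeasure E {z | s < ‖weightedBesselSTFT k h z‖} ≤
        A * ENNReal.ofReal s⁻¹ * ∫⁻ x, ‖h x‖ₑ := by
  obtain ⟨C, hC, hb⟩ := exists_norm_besselSTFT_le E hk
  have hT := lintegral_freqWeight_ne_top (E := E)
  have hW : ∫⁻ v : E, ENNReal.ofReal (rexp (-‖v‖)) ≠ ∞ :=
    integrable_exp_neg_norm.lintegral_lt_top.ne
  set n := Module.finrank ℝ E with hn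
  refine ⟨ENNReal.ofReal (2 ^ n * C) * (∫⁻ ξ : E, freqWeight ξ) *
    ∫⁻ v : E, ENNReal.ofReal (rexp (-‖v‖)), by finiteness, fun h hh s hs => ?_⟩
  have hm := measurable_weightedBesselSTFT k hh
  have hw : Measurable fun z : E × E => freqWeight z.2 :=
    measurable_freqWeight.comp measurable_snd
  have hSm : MeasurableSet {z | s < ‖weightedBesselSTFT k h z‖} :=
    measurableSet_lt measurable_const hm.norm
  set H : E → ℝ := fun x => ∫ y, ‖h y‖ * rexp (-‖x - y‖) with hH
  have hH0 (x : E) : 0 ≤ H x := integral_nonneg fun y => by positivity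
  have hpt (x ξ : E) : ‖weightedBesselSTFT k h (x, ξ)‖ ≤
      C * H x * (1 + ‖ξ‖ ^ 2) ^ ((n : ℝ) / 2) := by
    have hX : 0 < 1 + ‖ξ‖ ^ 2 := by positivity
    rw [weightedBesselSTFT, norm_mul, Complex.norm_real, Real.norm_of_nonneg (by positivity)]
    refine (mul_le_mul_of_nonneg_left (hb h hh x ξ) (by positivity)).trans_eq ?_
    rw [show ((Module.finrank ℝ E : ℝ) + k) / 2 = (n : ℝ) / 2 + k / 2 by rw [hn]; ring,
      Real.rpow_add hX, Real.rpow_neg hX.le]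
    field_simp
    rfl
  calc phaseMeasure E {z | s < ‖weightedBesselSTFT k h z‖}
      = ∫⁻ x, ∫⁻ ξ, {z | s < ‖weightedBesselSTFT k h z‖}.indicator
          (fun z => freqWeight z.2) (x, ξ) := by
        rw [phaseMeasure, withDensity_apply _ hSm, ← lintegral_indicator hSm,
          Measure.volume_eq_prod, lintegral_prod _ (hw.indicator hSm).aemeasurable]
    _ ≤ ∫⁻ x, ∫⁻ ξ in {ξ : E | s < C * H x * (1 + ‖ξ‖ ^ 2) ^ ((n : ℝ) / 2)}, freqWeight ξ := by
        refine lintegral_mono fun x => ?_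
        rw [← lintegral_indicator (measurableSet_lt measurable_const (by fun_prop))]
        refine lintegral_mono fun ξ => ?_
        by_cases hz : s < ‖weightedBesselSTFT k h (x, ξ)‖
        · rw [Set.indicator_of_mem (by exact hz),
            Set.indicator_of_mem (by exact hz.trans_le (hpt x ξ))]
        · rw [Set.indicator_of_notMem (by exact hz)]
          exact zero_le
    _ ≤ ∫⁻ x, ENNReal.ofReal (2 ^ n * (s⁻¹ * (C * H x))) * ∫⁻ ξ : E, freqWeight ξ :=
        lintegral_mono fun x => setLIntegral_freqWeight_rpow_le hs (mul_nonneg hC.le (hH0 x))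
    _ = ENNReal.ofReal (2 ^ n * C) * ENNReal.ofReal s⁻¹ * (∫⁻ ξ : E, freqWeight ξ) *
          ∫⁻ x, ENNReal.ofReal (H x) := by
        rw [← lintegral_const_mul' _ _ (by finiteness)]
        refine lintegral_congr fun x => ?_
        rw [show 2 ^ n * (s⁻¹ * (C * H x)) = 2 ^ n * C * s⁻¹ * H x by ring,
          ENNReal.ofReal_mul (by positivity), ENNReal.ofReal_mul (by positivity)]
        ring
    _ ≤ ENNReal.ofReal (2 ^ n * C) * ENNReal.ofReal s⁻¹ * (∫⁻ ξ : E, freqWeight ξ) *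
          ((∫⁻ v : E, ENNReal.ofReal (rexp (-‖v‖))) * ∫⁻ y, ‖h y‖ₑ) := by
        gcongr
        calc ∫⁻ x, ENNReal.ofReal (H x)
            = ∫⁻ x, ∫⁻ y, ‖h y‖ₑ * ENNReal.ofReal (rexp (-‖x - y‖)) := by
              refine lintegral_congr fun x => ?_
              rw [hH, ofReal_integral_eq_lintegral_ofReal (integrable_norm_mul_exp_neg hh x)
                (.of_forall fun y => by positivity)]
              refine lintegral_congr fun y => ?_
              rw [ENNReal.ofReal_mul (norm_nonneg _), ofReal_norm]
          _ = ∫⁻ y, ∫⁻ x, ‖h y‖ₑ * ENNReal.ofReal (rexp (-‖x - y‖)) := by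
              refine lintegral_lintegral_swap ?_
              exact hh.aestronglyMeasurable.enorm.comp_snd.mul
                (Measurable.aemeasurable (by fun_prop))
          _ = ∫⁻ y, ‖h y‖ₑ * ∫⁻ v : E, ENNReal.ofReal (rexp (-‖v‖)) := by
              refine lintegral_congr fun y => ?_
              rw [lintegral_const_mul _ (by fun_prop),
                lintegral_sub_right_eq_self (fun v => ENNReal.ofReal (rexp (-‖v‖))) y]
          _ ≤ _ := by rw [lintegral_mul_const'' _ hh.aestronglyMeasurable.enorm, mul_comm]
    _ = _ := by ring

theorem lintegral_phaseMeasure_sq_le {k : ℝ} (hk : 0 ≤ k) {h : E → ℂ} (h1 : Integrable h)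
    (h2 : MemLp h 2) :
    ∫⁻ z, ‖weightedBesselSTFT k h z‖ₑ ^ 2 ∂phaseMeasure E ≤
      (∫⁻ v : E, ENNReal.ofReal (2 ^ k * ((1 + ‖v‖) ^ (2 * k) * rexp (-π * ‖v‖ ^ 2)))) *
        ∫⁻ y, ‖h y‖ₑ ^ 2 := by
  have h := lintegral_phaseMeasure_rpow k h1 (p := 2) (by norm_num)
  simp only [ENNReal.rpow_two, show 2 * (((Module.finrank ℝ E : ℝ) + k) / 2) -
    Module.finrank ℝ E = k by ring] at h
  exact h.trans_le (lintegral_besselSTFT_sq_le hk h1 h2)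

theorem weightedBesselSTFT_add {k : ℝ} (hk : 0 ≤ k) {h₁ h₂ : E → ℂ} (hh₁ : Integrable h₁)
    (hh₂ : Integrable h₂) (z : E × E) : weightedBesselSTFT k (h₁ + h₂) z =
      weightedBesselSTFT k h₁ z + weightedBesselSTFT k h₂ z := by
  simp only [weightedBesselSTFT, besselSTFT_add hk hh₁ hh₂, mul_add]

theorem exists_lintegral_besselSTFT_rpow_le (E : Type*) [NormedAddCommGroup E]
    [InnerProductSpace ℝ E] [FiniteDimensional ℝ E] [MeasurableSpace E] [BorelSpace E]
    [Nontrivial E] {p k : ℝ} (hp1 : 1 < p) (hp2 : p ≤ 2)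
    (hk : k = 2 * Module.finrank ℝ E * (1 / p - 1 / 2)) :
    ∃ C : ℝ≥0∞, C ≠ ∞ ∧ ∀ h : E → ℂ, Measurable h → Integrable h → MemLp h 2 →
      ∫⁻ z : E × E, ‖besselSTFT k h z.1 z.2‖ₑ ^ p ≤ C * ∫⁻ x, ‖h x‖ₑ ^ p := by
  have hn : (0 : ℝ) < Module.finrank ℝ E := by exact_mod_cast Module.finrank_pos (R := ℝ)
  rcases hp2.lt_or_eq with hp2 | rfl
  · have hk0 : 0 < k := by
      rw [hk]
      have : 1 / 2 < 1 / p := one_div_lt_one_div_of_lt (by linarith) hp2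
      have : 0 < 1 / p - 1 / 2 := by linarith
      positivity
    obtain ⟨A, hA, hweak⟩ := exists_phaseMeasure_weightedBesselSTFT_le E hk0
    have hB := lintegral_rpow_mul_exp_ne_top (E := E) (k := k)
    refine ⟨ENNReal.ofReal p * (A * 2 * ENNReal.ofReal (1 / (p - 1)) +
      (∫⁻ v : E, ENNReal.ofReal (2 ^ k * ((1 + ‖v‖) ^ (2 * k) * rexp (-π * ‖v‖ ^ 2)))) * 4 *
        ENNReal.ofReal (1 / (2 - p))), by finiteness, fun h hm h1 h2 => ?_⟩
    have hlm (t : ℝ) : MeasurableSet {x | t < ‖h x‖} := measurableSet_lt measurable_const hm.norm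
    have hsm (t : ℝ) : MeasurableSet {x | ‖h x‖ ≤ t} := measurableSet_le hm.norm measurable_const
    have heq : ∫⁻ z, ‖weightedBesselSTFT k h z‖ₑ ^ p ∂phaseMeasure E =
        ∫⁻ z : E × E, ‖besselSTFT k h z.1 z.2‖ₑ ^ p := by
      have hexp : p * ((Module.finrank ℝ E + k) / 2) - Module.finrank ℝ E = 0 := by
        rw [hk]
        field_simp
        ring
      simp [lintegral_phaseMeasure_rpow k h1 (by linarith : 0 ≤ p), hexp]
    rw [← heq]
    refine lintegral_enorm_rpow_le_of_split hp1 hp2 hm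
      (measurable_weightedBesselSTFT k h1).aemeasurable _ _
      (fun t => weightedBesselSTFT k ({x | t < ‖h x‖}.indicator h))
      (fun t => weightedBesselSTFT k ({x | ‖h x‖ ≤ t}.indicator h)) (fun t _ z => ?_)
      (fun t _ => (measurable_weightedBesselSTFT k (h1.indicator (hsm t))).aemeasurable)
      (fun t _ s hs => hweak _ (h1.indicator (hlm t)) s hs)
      (fun t _ => lintegral_phaseMeasure_sq_le hk0.le (h1.indicator (hsm t))
        (h2.indicator (hsm t)))
    rw [← weightedBesselSTFT_add hk0.le (h1.indicator (hlm t)) (h1.indicator (hsm t))]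
    congr 1
    ext x
    by_cases hx : t < ‖h x‖
    · simp [hx, hx.not_ge]
    · simp [hx, not_lt.1 hx]
  · obtain rfl : k = 0 := by rw [hk]; norm_num
    refine ⟨_, lintegral_rpow_mul_exp_ne_top (E := E) (k := 0), fun h _ h1 h2 => ?_⟩
    simpa only [ENNReal.rpow_two, Real.rpow_zero, ENNReal.ofReal_one, one_mul] using
      lintegral_besselSTFT_sq_le le_rfl h1 h2

theorem exists_lintegral_STFT_rpow_le {d : ℕ} (hd : 1 ≤ d) {p k : ℝ} (hp1 : 1 < p) (hp2 : p ≤ 2)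
    (hk : k = 2 * d * (1 / p - 1 / 2)) :
    ∃ C : ℝ≥0∞, C ≠ ∞ ∧ ∀ f : 𝓢(EuclideanSpace ℝ (Fin d), ℂ),
      ∫⁻ z : EuclideanSpace ℝ (Fin d) × EuclideanSpace ℝ (Fin d),
        ‖STFT (fun x => f x) z.1 z.2‖ₑ ^ p ≤
        C * ∫⁻ x, ‖IFT (fun ξ : EuclideanSpace ℝ (Fin d) =>
          (((1 + ‖ξ‖ ^ 2) ^ (k / 2) : ℝ) : ℂ) * FT (fun x => f x) ξ) x‖ₑ ^ p := by
  have : Nontrivial (EuclideanSpace ℝ (Fin d)) :=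
    Module.nontrivial_of_finrank_pos (R := ℝ) (by rw [finrank_euclideanSpace_fin]; omega)
  obtain ⟨C, hC, h⟩ := exists_lintegral_besselSTFT_rpow_le (EuclideanSpace ℝ (Fin d)) (k := k) hp1
    hp2 (by rw [finrank_euclideanSpace_fin, hk])
  refine ⟨C, hC, fun f => ?_⟩
  have hg := Function.hasTemperateGrowth_one_add_norm_sq_rpow (EuclideanSpace ℝ (Fin d)) (k / 2)
  set φ : 𝓢(EuclideanSpace ℝ (Fin d), ℂ) := SchwartzMap.smulLeftCLM ℂ
    (fun ξ : EuclideanSpace ℝ (Fin d) => (1 + ‖ξ‖ ^ 2) ^ (k / 2)) (𝓕 f) with hφ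
  have hφf (ξ : EuclideanSpace ℝ (Fin d)) :
      φ ξ = (((1 + ‖ξ‖ ^ 2) ^ (k / 2) : ℝ) : ℂ) * 𝓕 (fun x => f x) ξ := by
    rw [hφ, SchwartzMap.smulLeftCLM_apply_apply hg, Complex.real_smul, SchwartzMap.fourier_coe]
  set b : 𝓢(EuclideanSpace ℝ (Fin d), ℂ) := 𝓕⁻ φ with hb
  have hbφ : 𝓕 (fun x => b x) = φ := by
    rw [← SchwartzMap.fourier_coe, hb, FourierTransform.fourier_fourierInv_eq]
  have hbI : (IFT fun ξ : EuclideanSpace ℝ (Fin d) =>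
      (((1 + ‖ξ‖ ^ 2) ^ (k / 2) : ℝ) : ℂ) * FT (fun x => f x) ξ) = fun x => b x := by
    rw [IFT_eq_fourierInv, FT_eq_fourier, ← funext hφf, hb, SchwartzMap.fourierInv_coe]
  have hS (z : EuclideanSpace ℝ (Fin d) × EuclideanSpace ℝ (Fin d)) :
      ‖STFT (fun x => f x) z.1 z.2‖ₑ = ‖besselSTFT k (fun x => b x) z.1 z.2‖ₑ := by
    rw [← ofReal_norm, ← ofReal_norm, norm_STFT_eq f.integrable, besselSTFT]
    congr 4
    ext η
    have hX : 0 < 1 + ‖η‖ ^ 2 := by positivity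
    rw [hbφ, hφf, mul_right_comm _ (𝓕 (fun x => f x) η), ← Complex.ofReal_mul,
      ← Real.rpow_add hX, add_neg_cancel, Real.rpow_zero, Complex.ofReal_one, one_mul]
  simp only [hS, hbI]
  exact h _ b.continuous.measurable b.integrable (b.memLp 2)

theorem eLpNorm_le_of_lintegral_rpow_le {α β F G : Type*} [MeasurableSpace α] [MeasurableSpace β]
    [NormedAddCommGroup F] [NormedAddCommGroup G] {μ : Measure α} {ν : Measure β} {u : α → F}
    {v : β → G} {p : ℝ} (hp : 0 < p) {C : ℝ≥0∞}
    (h : ∫⁻ x, ‖u x‖ₑ ^ p ∂μ ≤ C * ∫⁻ y, ‖v y‖ₑ ^ p ∂ν) :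
    eLpNorm u (ENNReal.ofReal p) μ ≤ C ^ (1 / p) * eLpNorm v (ENNReal.ofReal p) ν := by
  have hp0 : ENNReal.ofReal p ≠ 0 := by simpa using hp
  rw [eLpNorm_eq_lintegral_rpow_enorm_toReal hp0 ENNReal.ofReal_ne_top,
    eLpNorm_eq_lintegral_rpow_enorm_toReal hp0 ENNReal.ofReal_ne_top,
    ENNReal.toReal_ofReal hp.le, ← ENNReal.mul_rpow_of_nonneg _ _ (by positivity)]
  gcongr

end FirstEmbedding

/-- **Embeddings between Sobolev, modulation and Lebesgue spaces** (Kobayashi–Sugimoto):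
for `1 < p ≤ 2` and `k = 2d(1/p - 1/2)`, the continuous embeddings
`L^p_k(ℝ^d) ↪ M^p(ℝ^d) ↪ L^p(ℝ^d)` hold. -/
theorem sobolev_embeds_modulation_embeds_Lp
    {d : ℕ} (hd : 1 ≤ d) (p k : ℝ) (hp1 : 1 < p) (hp2 : p ≤ 2)
    (hk : k = 2 * d * (1 / p - 1 / 2)) :
    ∃ C : ℝ, 0 < C ∧ ∀ f : SchwartzMap (EuclideanSpace ℝ (Fin d)) ℂ,
      MpNorm p (fun x => f x) ≤ ENNReal.ofReal C * sobolevNorm p k (fun x => f x) ∧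
      eLpNorm (fun x => f x) (ENNReal.ofReal p) volume ≤
        ENNReal.ofReal C * MpNorm p (fun x => f x) := by
  have hp : 0 < p := by linarith
  obtain ⟨C₁, hC₁, h₁⟩ := exists_lintegral_STFT_rpow_le hd hp1 hp2 hk
  obtain ⟨C₂, hC₂, h₂⟩ := exists_lintegral_rpow_le_STFT d hp1 hp2
  have hD : C₁ ^ (1 / p) + C₂ ^ (1 / p) ≠ ∞ := by finiteness
  have hle : C₁ ^ (1 / p) + C₂ ^ (1 / p) ≤
      ENNReal.ofReal ((C₁ ^ (1 / p) + C₂ ^ (1 / p)).toReal + 1) :=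
    (ENNReal.ofReal_toReal hD).symm.trans_le (ENNReal.ofReal_le_ofReal (by linarith))
  refine ⟨(C₁ ^ (1 / p) + C₂ ^ (1 / p)).toReal + 1, by positivity, fun f => ⟨?_, ?_⟩⟩
  · refine (eLpNorm_le_of_lintegral_rpow_le hp (h₁ f)).trans ?_
    exact mul_le_mul_left (le_self_add.trans hle) _
  · refine (eLpNorm_le_of_lintegral_rpow_le hp (h₂ f)).trans ?_
    exact mul_le_mul_left (le_add_self.trans hle) _
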